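/- Let $(M,g)$ be a real smooth 4-dimensional Lorentzian spin manifold, signature $(+,-,-,-)$, with Levi-Civita connection $\nabla$ (extended to spinors), which is Einstein, i.e. $R_{ab}=6\Lambda g_{ab}$ with $\Lambda$ constant (equivalently, the trace-free Ricci spinor vanishes and $R=24\Lambda$ is constant). Let $(o^A,\iota^A)$ be a smooth spin dyad on $M$, $o_A\iota^A=1$, let $\Psi_{ABCD}$ be the Weyl spinor and let $\Psi_0=\Psi_{ABCD}o^Ao^Bo^Co^D$, $\Psi_1=\Psi_{ABCD}o^Ao^Bo^C\iota^D$, $\Psi_2=\Psi_{ABCD}o^Ao^B\iota^C\iota^D$, $\Psi_3=\Psi_{ABCD}o^A\iota^B\iota^C\iota^D$. Suppose that $(M,g)$ is of Petrov type II with repeated principal spinor $o^A$, in the sense that $\Psi_0=\Psi_1=0$ and $\Psi_2\neq0$ everywhere on $M$. Let $\Psi_2^{1/3}$ be a smooth branch on $M$ of the cube root of $\Psi_2$ and define $$K_{AB}=\Psi_2^{-1/3}\,o_{(A}\iota_{B)}-\tfrac13\Psi_2^{-4/3}\Psi_3\,o_Ao_B,\qquad \xi_{AA'}=\nabla^B{}_{A'}K_{AB},$$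 with $\Psi_2^{-1/3}=(\Psi_2^{1/3})^{-1}$ and $\Psi_2^{-4/3}=(\Psi_2^{1/3})^{-4}$. Then $\xi$ solves the projected Killing equation $$o^A\left(\nabla_{AA'}\xi_{BB'}+\nabla_{BB'}\xi_{AA'}\right)=0 .$$ -/

import Mathlib

open scoped Manifold ContDiff

noncomputable section

namespace TypeII

/-! ### Lorentzian manifolds and the Levi-Civita connection -/

/-- The Minkowski matrix `η = diag(1, -1, -1, -1)`. -/
def eta (a b : Fin 4) : ℝ := if a = b then (if a = 0 then 1 else -1) else 0

section Geometry

variable {M : Type*} [TopologicalSpace M] [ChartedSpace (EuclideanSpace ℝ (Fin 4)) M]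

/-- A vector field on `M`, without any regularity. -/
abbrev VField (M : Type*) [TopologicalSpace M] [ChartedSpace (EuclideanSpace ℝ (Fin 4)) M] :=
  (x : M) → TangentSpace (𝓡 4) x

/-- A smooth vector field. -/
def SmoothVField [IsManifold (𝓡 4) ∞ M] (X : VField M) : Prop :=
  ContMDiff (𝓡 4) (𝓡 4).tangent ∞ (fun x => (⟨x, X x⟩ : TangentBundle (𝓡 4) M))

/-- A vector field that is differentiable at `x`. -/
def DiffVFieldAt [IsManifold (𝓡 4) ∞ M] (X : VField M) (x : M) : Prop :=
  MDifferentiableAt (𝓡 4) (𝓡 4).tangent (fun y => (⟨y, X y⟩ : TangentBundle (𝓡 4) M)) x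

/-- A smooth metric of signature `(+,-,-,-)` on the real 4-manifold `M`. -/
structure LorentzMetric (M : Type*) [TopologicalSpace M]
    [ChartedSpace (EuclideanSpace ℝ (Fin 4)) M] [IsManifold (𝓡 4) ∞ M] where
  inner (x : M) : TangentSpace (𝓡 4) x →L[ℝ] TangentSpace (𝓡 4) x →L[ℝ] ℝ
  symm (x : M) (v w : TangentSpace (𝓡 4) x) : inner x v w = inner x w v
  signature (x : M) : ∃ b : Module.Basis (Fin 4) ℝ (TangentSpace (𝓡 4) x),
    ∀ i j, inner x (b i) (b j) = eta i j
  contMDiff : ContMDiff (𝓡 4)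
    ((𝓡 4).prod 𝓘(ℝ, EuclideanSpace ℝ (Fin 4) →L[ℝ] EuclideanSpace ℝ (Fin 4) →L[ℝ] ℝ)) ∞
    (fun x => Bundle.TotalSpace.mk'
      (EuclideanSpace ℝ (Fin 4) →L[ℝ] EuclideanSpace ℝ (Fin 4) →L[ℝ] ℝ)
      (E := fun x : M => TangentSpace (𝓡 4) x →L[ℝ] TangentSpace (𝓡 4) x →L[ℝ] ℝ) x (inner x))

/-- A covariant derivative on the tangent bundle; `D Y x v` is `∇_v Y` at `x`. -/
abbrev AffineConnection (M : Type*) [TopologicalSpace M]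
    [ChartedSpace (EuclideanSpace ℝ (Fin 4)) M] [IsManifold (𝓡 4) ∞ M] :=
  CovariantDerivative (𝓡 4) (EuclideanSpace ℝ (Fin 4)) (TangentSpace (𝓡 4) : M → Type _)

variable [IsManifold (𝓡 4) ∞ M]

/-- `D` is the Levi-Civita connection of `g`: it is torsion-free and metric. -/
structure IsLeviCivita (g : LorentzMetric M) (D : AffineConnection M) : Prop where
  torsion_free : ∀ (X Y : VField M) (x : M), DiffVFieldAt X x → DiffVFieldAt Y x →
    D Y x (X x) - D X x (Y x) = VectorField.mlieBracket (𝓡 4) X Y x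
  metric : ∀ (Y Z : VField M) (x : M), DiffVFieldAt Y x → DiffVFieldAt Z x →
    ∀ v : TangentSpace (𝓡 4) x,
      mfderiv (𝓡 4) 𝓘(ℝ, ℝ) (fun y => g.inner y (Y y) (Z y)) x v
        = g.inner x (D Y x v) (Z x) + g.inner x (Y x) (D Z x v)

/-- The curvature `(∇_X ∇_Y - ∇_Y ∇_X - ∇_{[X,Y]}) Z`. -/
def curvature (D : AffineConnection M) (X Y Z : VField M) : VField M := fun x =>
  D (fun y => D Z y (Y y)) x (X x) - D (fun y => D Z y (X y)) x (Y x)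
    - D Z x (VectorField.mlieBracket (𝓡 4) X Y x)

/-! ### Spin dyads

A spin dyad `(o, ι)`, `o_A ι^A = 1`, on a spin 4-manifold is a global frame of the spinor bundle
`S`.  It identifies `S` with `M × ℂ²`, so that `o^A = (1,0)`, `ι^A = (0,1)` and `ε_{01} = 1`, and
the isomorphism `TM ⊗ ℂ ≅ S ⊗ S'` with the null tetrad
`l = o ō`, `m = o ῑ`, `m̄ = ι ō`, `n = ι ῑ`, that is with the orthonormal frame `e₀, …, e₃` for which
`l = (e₀+e₃)/√2`, `m = (e₁-i e₂)/√2`, `m̄ = (e₁+i e₂)/√2`, `n = (e₀-e₃)/√2`.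
Conversely every smooth orthonormal frame arises in this way.  All spinor fields below are given by
their components in the dyad. -/

/-- A spin dyad on `(M, g)`, given by its orthonormal frame. -/
structure SpinDyad (g : LorentzMetric M) where
  e : Fin 4 → VField M
  smooth : ∀ a, SmoothVField (e a)
  orthonormal : ∀ a b x, g.inner x (e a x) (e b x) = eta a b

end Geometry

/-! ### Spinor algebra -/

/-- The contravariant components `o^A` of the first leg of the dyad. -/
def o : Fin 2 → ℂ := ![1, 0]

/-- The contravariant components `ι^A` of the second leg of the dyad. -/
def iota : Fin 2 → ℂ := ![0, 1]

/-- `ε_{AB}`, and also `ε^{AB}`, `ε_{A'B'}`, `ε^{A'B'}`: all four have the same components. -/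
def eps : Fin 2 → Fin 2 → ℂ := ![![0, 1], ![-1, 0]]

/-- Lowering an index: `κ_B = κ^A ε_{AB}`. -/
def lower (k : Fin 2 → ℂ) (B : Fin 2) : ℂ := ∑ A, k A * eps A B

/-- The Infeld-van der Waerden symbols `σ^a_{AA'}`: the vector `e_{AA'} = ∑ₐ σ^a_{AA'} eₐ` is
`l`, `m`, `m̄`, `n` for `AA' = 00', 01', 10', 11'`. -/
def ivdw (A A' : Fin 2) : Fin 4 → ℂ :=
  fun a => (1 / (Real.sqrt 2 : ℂ)) *
    (![![![1, 0, 0, 1], ![0, 1, -Complex.I, 0]],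
       ![![0, 1, Complex.I, 0], ![1, 0, 0, -1]]] : Fin 2 → Fin 2 → Fin 4 → ℂ) A A' a

section Fields

variable {M : Type*} [TopologicalSpace M] [ChartedSpace (EuclideanSpace ℝ (Fin 4)) M]
  [IsManifold (𝓡 4) ∞ M] {g : LorentzMetric M}

/-! ### The spinor connection -/

/-- The derivative `eₐ f` of a complex scalar field. -/
def frameDeriv (d : SpinDyad g) (a : Fin 4) (f : M → ℂ) (x : M) : ℂ :=
  mfderiv (𝓡 4) 𝓘(ℝ, ℂ) f x (d.e a x)

/-- The connection coefficients `ω_{abc} = g(∇_{eₐ} e_b, e_c)` of the frame. -/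
def connCoeff (D : AffineConnection M) (d : SpinDyad g) (a b c : Fin 4) (x : M) : ℝ :=
  g.inner x (D (d.e b) x (d.e a x)) (d.e c x)

/-- `Γ_{aBC} = ½ ε^{B'C'} ω_{a BB' CC'}`, from the decomposition
`ω_{a BB' CC'} = Γ_{aBC} ε_{B'C'} + Γ̄_{aB'C'} ε_{BC}`. -/
def spinCoeffLow (D : AffineConnection M) (d : SpinDyad g) (a : Fin 4) (B C : Fin 2) (x : M) : ℂ :=
  (1 / 2) * ∑ B', ∑ C', eps B' C' *
    ∑ b, ∑ c, ivdw B B' b * ivdw C C' c * (connCoeff D d a b c x : ℂ)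

/-- `Γ_{aB}{}^C = ε^{CD} Γ_{aBD}`; thus `∇ₐ κ^C = eₐ κ^C + Γ_{aB}{}^C κ^B`, and this connection on
`S` is the one induced by the Levi-Civita connection. -/
def spinCoeff (D : AffineConnection M) (d : SpinDyad g) (a : Fin 4) (B C : Fin 2) (x : M) : ℂ :=
  ∑ E, eps C E * spinCoeffLow D d a B E x

/-- `∇_{AA'} K_{BC} = σ^a_{AA'} (eₐ K_{BC} - Γ_{aB}{}^E K_{EC} - Γ_{aC}{}^E K_{BE})`. -/
def nablaK (D : AffineConnection M) (d : SpinDyad g) (K : Fin 2 → Fin 2 → M → ℂ)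
    (A A' B C : Fin 2) (x : M) : ℂ :=
  ∑ a, ivdw A A' a * (frameDeriv d a (K B C) x
    - ∑ E, spinCoeff D d a B E x * K E C x - ∑ E, spinCoeff D d a C E x * K B E x)

/-- `∇_{AA'} ξ_{BB'} = σ^a_{AA'} (eₐ ξ_{BB'} - Γ_{aB}{}^E ξ_{EB'} - Γ̄_{aB'}{}^{E'} ξ_{BE'})`. -/
def nablaXi (D : AffineConnection M) (d : SpinDyad g) (xi : Fin 2 → Fin 2 → M → ℂ)
    (A A' B B' : Fin 2) (x : M) : ℂ :=
  ∑ a, ivdw A A' a * (frameDeriv d a (xi B B') x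
    - ∑ E, spinCoeff D d a B E x * xi E B' x
    - ∑ E', (starRingEnd ℂ) (spinCoeff D d a B' E' x) * xi B E' x)

/-! ### Curvature -/

/-- `R_{abcd} = g(R(eₐ, e_b) e_c, e_d)`, i.e. `(∇ₐ∇_b - ∇_b∇ₐ) V^d = R_{abc}{}^d V^c`. -/
def riemann (D : AffineConnection M) (d : SpinDyad g) (a b c f : Fin 4) (x : M) : ℝ :=
  g.inner x (curvature D (d.e a) (d.e b) (d.e c) x) (d.e f x)

/-- `R_{ac} = g^{bd} R_{abcd}`. -/
def ricci (D : AffineConnection M) (d : SpinDyad g) (a c : Fin 4) (x : M) : ℝ :=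
  ∑ b, ∑ f, eta b f * riemann D d a b c f x

/-- The scalar curvature `R = g^{ac} R_{ac}`. -/
def scalarCurv (D : AffineConnection M) (d : SpinDyad g) (x : M) : ℝ :=
  ∑ a, ∑ c, eta a c * ricci D d a c x

/-- The Weyl tensor `C_{abcd}`. -/
def weyl (D : AffineConnection M) (d : SpinDyad g) (a b c f : Fin 4) (x : M) : ℝ :=
  riemann D d a b c f x
    - (1 / 2) * (eta a c * ricci D d b f x - eta a f * ricci D d b c x
        - eta b c * ricci D d a f x + eta b f * ricci D d a c x)
    + (1 / 6) * scalarCurv D d x * (eta a c * eta b f - eta a f * eta b c)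

/-- The Weyl spinor `Ψ_{ABCD} = ¼ ε^{A'B'} ε^{C'D'} C_{AA'BB'CC'DD'}`, from the decomposition
`C_{abcd} = Ψ_{ABCD} ε_{A'B'} ε_{C'D'} + Ψ̄_{A'B'C'D'} ε_{AB} ε_{CD}`. -/
def weylSpinor (D : AffineConnection M) (d : SpinDyad g) (A B C E : Fin 2) (x : M) : ℂ :=
  (1 / 4) * ∑ A', ∑ B', ∑ C', ∑ E', eps A' B' * eps C' E' *
    ∑ a, ∑ b, ∑ c, ∑ f, ivdw A A' a * ivdw B B' b * ivdw C C' c * ivdw E E' f *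
      (weyl D d a b c f x : ℂ)

/-- The contraction `Ψ_{ABCD} α^A β^B γ^C δ^D`. -/
def weylContr (D : AffineConnection M) (d : SpinDyad g) (p q r s : Fin 2 → ℂ) (x : M) : ℂ :=
  ∑ A, ∑ B, ∑ C, ∑ E, weylSpinor D d A B C E x * p A * q B * r C * s E

/-- `Ψ₀ = Ψ_{ABCD} o^A o^B o^C o^D`. -/
def Psi0 (D : AffineConnection M) (d : SpinDyad g) : M → ℂ := weylContr D d o o o o

/-- `Ψ₁ = Ψ_{ABCD} o^A o^B o^C ι^D`. -/
def Psi1 (D : AffineConnection M) (d : SpinDyad g) : M → ℂ := weylContr D d o o o iota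

/-- `Ψ₂ = Ψ_{ABCD} o^A o^B ι^C ι^D`. -/
def Psi2 (D : AffineConnection M) (d : SpinDyad g) : M → ℂ := weylContr D d o o iota iota

/-- `Ψ₃ = Ψ_{ABCD} o^A ι^B ι^C ι^D`. -/
def Psi3 (D : AffineConnection M) (d : SpinDyad g) : M → ℂ := weylContr D d o iota iota iota

/-- The metric is Einstein: `R_{ab} = 6Λ g_{ab}` for a constant `Λ`; equivalently the trace-free
Ricci tensor vanishes and `R = 24Λ` is constant. -/
def IsEinstein (D : AffineConnection M) (d : SpinDyad g) : Prop :=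
  ∃ L : ℝ, ∀ a b x, ricci D d a b x = 6 * L * eta a b

/-- Petrov type II with repeated principal spinor `o`. -/
def IsTypeII (D : AffineConnection M) (d : SpinDyad g) : Prop :=
  ∀ x, Psi0 D d x = 0 ∧ Psi1 D d x = 0 ∧ Psi2 D d x ≠ 0

/-! ### The spinor `K` and the vector `ξ` -/

/-- `K_{AB} = φ⁻¹ o_{(A} ι_{B)} - (1/3) φ⁻⁴ Ψ₃ o_A o_B`, where `φ = Ψ₂^{1/3}`. -/
def projK (D : AffineConnection M) (d : SpinDyad g) (phi : M → ℂ) (A B : Fin 2) (x : M) : ℂ :=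
  (phi x)⁻¹ * ((1 / 2) * (lower o A * lower iota B + lower o B * lower iota A))
    - (1 / 3) * ((phi x) ^ 4)⁻¹ * Psi3 D d x * lower o A * lower o B

/-- `ξ_{AA'} = ∇^B{}_{A'} K_{AB} = ε^{BC} ∇_{CA'} K_{AB}`. -/
def projXi (D : AffineConnection M) (d : SpinDyad g) (phi : M → ℂ) (A A' : Fin 2) (x : M) : ℂ :=
  ∑ B, ∑ C, eps B C * nablaK D d (projK D d phi) C A' A B x

end Fields

end TypeII

end

noncomputable section

namespace TypeII

section FrameCalculus

open VectorField

variable {M : Type*} [TopologicalSpace M] [ChartedSpace (EuclideanSpace ℝ (Fin 4)) M]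
  [IsManifold (𝓡 4) ∞ M] {g : LorentzMetric M}

/-! ### Smooth vector fields -/

lemma isManifold_of_le_infty (n : ℕ∞) : IsManifold (𝓡 4) (n : WithTop ℕ∞) M :=
  IsManifold.of_le (n := ∞) (by exact_mod_cast le_top)

lemma SmoothVField.diffAt {X : VField M} (hX : SmoothVField X) (x : M) : DiffVFieldAt X x :=
  (hX x).mdifferentiableAt (by simp)

lemma SmoothVField.inner {X Y : VField M} (hX : SmoothVField X) (hY : SmoothVField Y) :
    ContMDiff (𝓡 4) 𝓘(ℝ, ℝ) ∞ (fun x => g.inner x (X x) (Y x)) := by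
  intro x
  have : ContMDiffAt (𝓡 4) ((𝓡 4).prod 𝓘(ℝ)) ∞
      (fun m ↦ Bundle.TotalSpace.mk' ℝ (E := Bundle.Trivial M ℝ) m (g.inner m (X m) (Y m))) x := by
    apply ContMDiffAt.clm_bundle_apply₂ (F₁ := EuclideanSpace ℝ (Fin 4))
      (F₂ := EuclideanSpace ℝ (Fin 4))
    · exact g.contMDiff x
    · exact hX x
    · exact hY x
  simp only [Bundle.contMDiffAt_totalSpace] at this
  exact this.2

lemma SmoothVField.lie {X Y : VField M} (hX : SmoothVField X) (hY : SmoothVField Y) :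
    SmoothVField (mlieBracket (𝓡 4) X Y) := by
  have : IsManifold (𝓡 4) (((⊤ : ℕ∞) : WithTop ℕ∞) + 1) M := by
    simpa using (inferInstance : IsManifold (𝓡 4) ∞ M)
  have : IsManifold (𝓡 4) (minSmoothness ℝ 2) M := by
    simpa using isManifold_of_le_infty (M := M) 2
  exact ContDiff.mlieBracket_vectorField (m := ⊤) (n := ⊤) hX hY (by simp)

lemma SmoothVField.smul {X : VField M} {f : M → ℝ} (hX : SmoothVField X)
    (hf : ContMDiff (𝓡 4) 𝓘(ℝ, ℝ) ∞ f) : SmoothVField (f • X) :=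
  ContMDiff.smul_section hf hX

lemma SmoothVField.sum {ι : Type*} {s : Finset ι} {X : ι → VField M}
    (hX : ∀ i ∈ s, SmoothVField (X i)) : SmoothVField (∑ i ∈ s, X i) := by
  have := ContMDiff.sum_section (I := 𝓡 4) (t := X) hX
  simpa [SmoothVField, Finset.sum_apply] using this

/-- The derivative of `f` along the vector field `X`. -/
def dir {F : Type*} [NormedAddCommGroup F] [NormedSpace ℝ F] (X : VField M) (f : M → F) (x : M) :
    F :=
  mfderiv (𝓡 4) 𝓘(ℝ, F) f x (X x)

omit [IsManifold (𝓡 4) ∞ M] in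
lemma dir_neg {f : M → ℝ} (X : VField M) (x : M) : dir X (-f) x = - dir X f x := by
  unfold dir
  rw [mfderiv_neg]
  rfl

lemma SmoothVField.dir {F : Type*} [NormedAddCommGroup F] [NormedSpace ℝ F]
    {X : VField M} {f : M → F} (hX : SmoothVField X)
    (hf : ContMDiff (𝓡 4) 𝓘(ℝ, F) ∞ f) :
    ContMDiff (𝓡 4) 𝓘(ℝ, F) ∞ (dir X f) := by
  have h1 : ContMDiff (𝓡 4).tangent 𝓘(ℝ, F).tangent ∞ (tangentMap (𝓡 4) 𝓘(ℝ, F) f) :=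
    hf.contMDiff_tangentMap (by simp)
  exact (contMDiff_snd_tangentBundle_modelSpace F 𝓘(ℝ, F)).comp (h1.comp hX)

lemma jacobi {X Y Z : VField M} (hX : SmoothVField X) (hY : SmoothVField Y)
    (hZ : SmoothVField Z) (x : M) :
    mlieBracket (𝓡 4) X (mlieBracket (𝓡 4) Y Z) x =
      mlieBracket (𝓡 4) (mlieBracket (𝓡 4) X Y) Z x
        + mlieBracket (𝓡 4) Y (mlieBracket (𝓡 4) X Z) x := by
  have : IsManifold (𝓡 4) (minSmoothness ℝ 3) M := by
    simpa using isManifold_of_le_infty (M := M) 3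
  have h2 : minSmoothness ℝ 2 ≤ (∞ : WithTop ℕ∞) := by
    simp only [minSmoothness_of_isRCLikeNormedField]
    exact WithTop.coe_le_coe.2 (le_top : (2 : ℕ∞) ≤ ⊤)
  exact leibniz_identity_mlieBracket_apply ((hX x).of_le h2) ((hY x).of_le h2) ((hZ x).of_le h2)

lemma lie_smul_right {X Y : VField M} {f : M → ℝ} (hY : SmoothVField Y)
    (hf : ContMDiff (𝓡 4) 𝓘(ℝ, ℝ) ∞ f) (x : M) :
    mlieBracket (𝓡 4) X (f • Y) x = dir X f x • Y x + f x • mlieBracket (𝓡 4) X Y x := by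
  have : IsManifold (𝓡 4) 1 M := isManifold_of_le_infty (M := M) 1
  exact mlieBracket_smul_right ((hf x).mdifferentiableAt (by simp)) (hY.diffAt x)

/-- The Lie bracket acts on functions as the commutator. -/
lemma dir_lie {X Y Z : VField M} {f : M → ℝ} (hX : SmoothVField X) (hY : SmoothVField Y)
    (hZ : SmoothVField Z) (hf : ContMDiff (𝓡 4) 𝓘(ℝ, ℝ) ∞ f) (x : M) (hZx : Z x ≠ 0) :
    dir (mlieBracket (𝓡 4) X Y) f x = dir X (dir Y f) x - dir Y (dir X f) x := by
  have key : ∀ {X Y : VField M}, SmoothVField X → SmoothVField Y →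
      mlieBracket (𝓡 4) X (mlieBracket (𝓡 4) Y (f • Z)) x =
      dir X (dir Y f) x • Z x + dir Y f x • mlieBracket (𝓡 4) X Z x
      + (dir X f x • mlieBracket (𝓡 4) Y Z x
      + f x • mlieBracket (𝓡 4) X (mlieBracket (𝓡 4) Y Z) x) := by
    intro X Y hX hY
    have : IsManifold (𝓡 4) 1 M := isManifold_of_le_infty (M := M) 1
    have e : mlieBracket (𝓡 4) Y (f • Z) = dir Y f • Z + f • mlieBracket (𝓡 4) Y Z := by
      funext y; exact lie_smul_right hZ hf y
    have hd := hY.dir hf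
    rw [e, mlieBracket_add_right ((hZ.smul hd).diffAt x) (((hY.lie hZ).smul hf).diffAt x),
      lie_smul_right hZ hd, lie_smul_right (hY.lie hZ) hf]
  have J := jacobi hX hY (hZ.smul hf) x
  rw [key hX hY, key hY hX, lie_smul_right hZ hf, jacobi hX hY hZ] at J
  have : (dir (mlieBracket (𝓡 4) X Y) f x - (dir X (dir Y f) x - dir Y (dir X f) x)) • Z x
        = 0 := by
    have J' := sub_eq_zero.2 J
    rw [← neg_eq_zero, ← J']
    module
  rcases smul_eq_zero.1 this with h | h
  · exact sub_eq_zero.1 h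
  · exact absurd h hZx

end FrameCalculus

section FrameConnection

open VectorField

variable {M : Type*} [TopologicalSpace M] [ChartedSpace (EuclideanSpace ℝ (Fin 4)) M]
  [IsManifold (𝓡 4) ∞ M] {g : LorentzMetric M}

/-! ### The connection coefficients of the orthonormal frame -/

lemma eta_self_mul_self (a : Fin 4) : eta a a * eta a a = 1 := by
  unfold eta; split_ifs <;> simp_all

lemma eta_of_ne {a b : Fin 4} (h : a ≠ b) : eta a b = 0 := by simp [eta, h]

lemma SpinDyad.sum_inner (d : SpinDyad g) (x : M) (c : Fin 4 → ℝ) (b : Fin 4) :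
    g.inner x (∑ a, c a • d.e a x) (d.e b x) = c b * eta b b := by
  simp only [map_sum, map_smul, sum_apply, smul_apply,
    d.orthonormal, smul_eq_mul]
  rw [Finset.sum_eq_single b]
  · intro a _ h; simp [eta_of_ne h]
  · simp

lemma SpinDyad.linearIndependent (d : SpinDyad g) (x : M) :
    LinearIndependent ℝ (fun a => d.e a x) := by
  rw [Fintype.linearIndependent_iff]
  intro c hc b
  have h := d.sum_inner x c b
  rw [hc] at h
  have h2 := eta_self_mul_self b
  simp only [map_zero, zero_apply] at h
  linear_combination -c b * h2 - eta b b * h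

lemma SpinDyad.expand (d : SpinDyad g) (x : M) (v : TangentSpace (𝓡 4) x) :
    v = ∑ a, (eta a a * g.inner x v (d.e a x)) • d.e a x := by
  have hfin : Module.finrank ℝ (TangentSpace (𝓡 4) x) = 4 := by
    change Module.finrank ℝ (EuclideanSpace ℝ (Fin 4)) = 4
    simp
  have : FiniteDimensional ℝ (TangentSpace (𝓡 4) x) := by
    change FiniteDimensional ℝ (EuclideanSpace ℝ (Fin 4))
    infer_instance
  have hspan : v ∈ Submodule.span ℝ (Set.range (fun a => d.e a x)) := by
    rw [(d.linearIndependent x).span_eq_top_of_card_eq_finrank (by simp [hfin])]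
    trivial
  obtain ⟨c, rfl⟩ := (Submodule.mem_span_range_iff_exists_fun ℝ).1 hspan
  refine Finset.sum_congr rfl fun a _ => ?_
  rw [d.sum_inner]
  congr 1
  linear_combination -c a * eta_self_mul_self a

variable {D : AffineConnection M} {d : SpinDyad g}

lemma cov_frame (a b : Fin 4) (x : M) :
    D (d.e b) x (d.e a x) = ∑ c, (eta c c * connCoeff D d a b c x) • d.e c x :=
  d.expand x _

lemma connCoeff_antisymm (hD : IsLeviCivita g D) (a b c : Fin 4) (x : M) :
    connCoeff D d a c b x = - connCoeff D d a b c x := by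
  have h := hD.metric (d.e b) (d.e c) x ((d.smooth b).diffAt x) ((d.smooth c).diffAt x) (d.e a x)
  have : (fun y => g.inner y (d.e b y) (d.e c y)) = fun _ => eta b c := by
    funext y; exact d.orthonormal b c y
  rw [this, mfderiv_const] at h
  have h' : (0 : ℝ) = connCoeff D d a b c x + g.inner x (d.e b x) (D (d.e c) x (d.e a x)) := h
  rw [g.symm] at h'
  change (0 : ℝ) = connCoeff D d a b c x + connCoeff D d a c b x at h'
  linarith

lemma inner_lie_frame (hD : IsLeviCivita g D) (a b c : Fin 4) (x : M) :
    g.inner x (mlieBracket (𝓡 4) (d.e a) (d.e b) x) (d.e c x)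
      = connCoeff D d a b c x - connCoeff D d b a c x := by
  rw [← hD.torsion_free _ _ x ((d.smooth a).diffAt x) ((d.smooth b).diffAt x)]
  simp [connCoeff]

lemma lie_frame (hD : IsLeviCivita g D) (a b : Fin 4) (x : M) :
    mlieBracket (𝓡 4) (d.e a) (d.e b) x
      = ∑ c, (eta c c * (connCoeff D d a b c x - connCoeff D d b a c x)) • d.e c x := by
  rw [d.expand x (mlieBracket (𝓡 4) (d.e a) (d.e b) x)]
  simp_rw [inner_lie_frame hD]

/-- The Koszul formula in an orthonormal frame. -/
lemma connCoeff_eq (hD : IsLeviCivita g D) (a b c : Fin 4) (x : M) :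
    connCoeff D d a b c x = (1 / 2) *
      (g.inner x (mlieBracket (𝓡 4) (d.e a) (d.e b) x) (d.e c x)
        - g.inner x (mlieBracket (𝓡 4) (d.e b) (d.e c) x) (d.e a x)
        + g.inner x (mlieBracket (𝓡 4) (d.e c) (d.e a) x) (d.e b x)) := by
  simp only [inner_lie_frame hD]
  linear_combination (1 / 2) * connCoeff_antisymm (d := d) hD a b c x
    + (1 / 2) * connCoeff_antisymm (d := d) hD b c a x
    - (1 / 2) * connCoeff_antisymm (d := d) hD c b a x

lemma connCoeff_smooth (hD : IsLeviCivita g D) (a b c : Fin 4) :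
    ContMDiff (𝓡 4) 𝓘(ℝ, ℝ) ∞ (connCoeff D d a b c) := by
  have h : ∀ a b c, ContMDiff (𝓡 4) 𝓘(ℝ, ℝ) ∞
      (fun x => g.inner x (mlieBracket (𝓡 4) (d.e a) (d.e b) x) (d.e c x)) := fun a b c =>
    ((d.smooth a).lie (d.smooth b)).inner (d.smooth c)
  have : connCoeff D d a b c = _ := funext fun x => connCoeff_eq (d := d) hD a b c x
  rw [this]
  exact contMDiff_const.mul (((h a b c).sub (h b c a)).add (h c a b))

lemma cov_frame_eq (a b : Fin 4) :
    (fun y => D (d.e b) y (d.e a y))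
      = ∑ c, (fun y => eta c c * connCoeff D d a b c y) • d.e c := by
  funext y
  rw [cov_frame (d := d) a b y, Finset.sum_apply]
  rfl

lemma smoothVField_cov_frame (hD : IsLeviCivita g D) (a b : Fin 4) :
    SmoothVField (fun y => D (d.e b) y (d.e a y)) := by
  rw [cov_frame_eq]
  exact SmoothVField.sum fun c _ =>
    (d.smooth c).smul (contMDiff_const.mul (connCoeff_smooth hD a b c))

lemma cov_add {X Y : VField M} (hX : SmoothVField X) (hY : SmoothVField Y) (x : M) :
    D (X + Y) x = D X x + D Y x :=
  D.isCovariantDerivativeOnUniv.add (hX.diffAt x) (hY.diffAt x)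

lemma cov_smul {X : VField M} {f : M → ℝ} (hX : SmoothVField X)
    (hf : ContMDiff (𝓡 4) 𝓘(ℝ, ℝ) ∞ f) (Y : VField M) (x : M) :
    D (f • X) x (Y x) = f x • D X x (Y x) + dir Y f x • X x := by
  have := D.isCovariantDerivativeOnUniv.leibniz (hX.diffAt x)
    ((hf x).mdifferentiableAt (by simp))
  rw [this]
  rfl

lemma cov_sum {ι : Type*} (s : Finset ι) {X : ι → VField M}
    (hX : ∀ i, SmoothVField (X i)) (x : M) :
    D (∑ i ∈ s, X i) x = ∑ i ∈ s, D (X i) x := by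
  classical
  induction s using Finset.induction_on with
  | empty => simp
  | insert i s hi ih =>
    rw [Finset.sum_insert hi, Finset.sum_insert hi, cov_add (hX i) (SmoothVField.sum fun i _ => hX i),
      ih]

lemma inner_cov_cov_frame (hD : IsLeviCivita g D) (a b c f : Fin 4) (x : M) :
    g.inner x (D (fun y => D (d.e c) y (d.e b y)) x (d.e a x)) (d.e f x)
      = dir (d.e a) (connCoeff D d b c f) x
        + ∑ h, eta h h * connCoeff D d b c h x * connCoeff D d a h f x := by
  have hs : ∀ h, ContMDiff (𝓡 4) 𝓘(ℝ, ℝ) ∞ (fun y => eta h h * connCoeff D d b c h y) :=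
    fun h => contMDiff_const.mul (connCoeff_smooth hD b c h)
  rw [cov_frame_eq, cov_sum _ fun h => (d.smooth h).smul (hs h), sum_apply]
  simp_rw [cov_smul (d.smooth _) (hs _)]
  rw [Finset.sum_add_distrib, map_add, add_apply, d.sum_inner, add_comm]
  congr 1
  · have : dir (d.e a) (fun y => eta f f * connCoeff D d b c f y) x
        = eta f f * dir (d.e a) (connCoeff D d b c f) x := by
      have := const_smul_mfderiv (((connCoeff_smooth (d := d) hD b c f) x).mdifferentiableAt (by simp))
        (eta f f)
      have h2 := congrArg (fun L => L (d.e a x)) this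
      exact h2
    rw [this]
    linear_combination dir (d.e a) (connCoeff D d b c f) x * eta_self_mul_self f
  · simp only [map_sum, map_smul, sum_apply, smul_apply,
      smul_eq_mul]
    rfl

/-- The curvature in terms of the connection coefficients. -/
lemma riemann_eq (hD : IsLeviCivita g D) (a b c f : Fin 4) (x : M) :
    riemann D d a b c f x
      = dir (d.e a) (connCoeff D d b c f) x - dir (d.e b) (connCoeff D d a c f) x
        + ∑ h, eta h h * (connCoeff D d b c h x * connCoeff D d a h f x
          - connCoeff D d a c h x * connCoeff D d b h f x)
        - ∑ h, eta h h * (connCoeff D d a b h x - connCoeff D d b a h x)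
          * connCoeff D d h c f x := by
  have h3 : g.inner x (D (d.e c) x (mlieBracket (𝓡 4) (d.e a) (d.e b) x)) (d.e f x)
      = ∑ h, eta h h * (connCoeff D d a b h x - connCoeff D d b a h x)
          * connCoeff D d h c f x := by
    rw [lie_frame hD]
    simp only [map_sum, map_smul, sum_apply, smul_apply,
      smul_eq_mul]
    rfl
  unfold riemann curvature
  rw [map_sub, map_sub, sub_apply, sub_apply, h3,
    inner_cov_cov_frame hD, inner_cov_cov_frame hD]
  simp only [mul_sub, Finset.sum_sub_distrib, ← mul_assoc]
  ring

lemma curvature_cyclic (hD : IsLeviCivita g D) {X Y Z : VField M} (hX : SmoothVField X)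
    (hY : SmoothVField Y) (hZ : SmoothVField Z)
    (hXY : SmoothVField fun y => D X y (Y y)) (hYX : SmoothVField fun y => D Y y (X y))
    (hXZ : SmoothVField fun y => D X y (Z y)) (hZX : SmoothVField fun y => D Z y (X y))
    (hYZ : SmoothVField fun y => D Y y (Z y)) (hZY : SmoothVField fun y => D Z y (Y y)) (x : M) :
    curvature D X Y Z x + curvature D Y Z X x + curvature D Z X Y x = 0 := by
  have key : ∀ {X Y Z : VField M}, SmoothVField X → SmoothVField Y → SmoothVField Z →
      (SmoothVField fun y => D Y y (Z y)) → (SmoothVField fun y => D Z y (Y y)) →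
      D (fun y => D Z y (Y y)) x (X x) - D (fun y => D Y y (Z y)) x (X x)
        - D X x (mlieBracket (𝓡 4) Y Z x) = mlieBracket (𝓡 4) X (mlieBracket (𝓡 4) Y Z) x := by
    intro X Y Z hX hY hZ hYZ hZY
    have e : (fun y => D Z y (Y y)) = mlieBracket (𝓡 4) Y Z + fun y => D Y y (Z y) := by
      funext y
      rw [Pi.add_apply, ← hD.torsion_free Y Z y (hY.diffAt y) (hZ.diffAt y)]
      simp
    rw [e, cov_add (hY.lie hZ) hYZ,
      ← hD.torsion_free X (mlieBracket (𝓡 4) Y Z) x (hX.diffAt x) ((hY.lie hZ).diffAt x)]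
    simp
  have k1 := key hX hY hZ hYZ hZY
  have k2 := key hY hZ hX hZX hXZ
  have k3 := key hZ hX hY hXY hYX
  have J := jacobi hX hY hZ x
  rw [mlieBracket_swap_apply (V := mlieBracket (𝓡 4) X Y) (W := Z), ← k1, ← k3,
    show mlieBracket (𝓡 4) X Z = - mlieBracket (𝓡 4) Z X from mlieBracket_swap,
    ← neg_one_smul ℝ (mlieBracket (𝓡 4) Z X)] at J
  have : IsManifold (𝓡 4) 1 M := isManifold_of_le_infty (M := M) 1
  rw [mlieBracket_const_smul_right ((hZ.lie hX).diffAt x), ← k2] at J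
  unfold curvature
  have J' := sub_eq_zero.2 J
  rw [← J']
  module

lemma riemann_cyclic (hD : IsLeviCivita g D) (a b c f : Fin 4) (x : M) :
    riemann D d a b c f x + riemann D d b c a f x + riemann D d c a b f x = 0 := by
  have s := smoothVField_cov_frame (d := d) hD
  have h := curvature_cyclic hD (d.smooth a) (d.smooth b) (d.smooth c) (s _ _) (s _ _) (s _ _)
    (s _ _) (s _ _) (s _ _) x
  have := congrArg (fun v => g.inner x v (d.e f x)) h
  simpa [riemann] using this

lemma riemann_antisymm_left (a b c f : Fin 4) (x : M) :
    riemann D d b a c f x = - riemann D d a b c f x := by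
  unfold riemann curvature
  rw [mlieBracket_swap_apply (V := d.e b)]
  simp only [map_sub, map_neg, sub_apply, neg_apply]
  ring

lemma riemann_antisymm_right (hD : IsLeviCivita g D) (a b c f : Fin 4) (x : M) :
    riemann D d a b f c x = - riemann D d a b c f x := by
  have e : ∀ p q r, connCoeff D d p r q = - connCoeff D d p q r :=
    fun p q r => funext fun y => connCoeff_antisymm hD p q r y
  rw [riemann_eq hD, riemann_eq hD, e b c f, e a c f, dir_neg, dir_neg]
  have h1 : ∀ h, connCoeff D d b f h x * connCoeff D d a h c x
      - connCoeff D d a f h x * connCoeff D d b h c x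
      = -(connCoeff D d b c h x * connCoeff D d a h f x
          - connCoeff D d a c h x * connCoeff D d b h f x) := by
    intro h
    rw [e b h f, e a c h, e a h f, e b c h]
    simp only [Pi.neg_apply]; ring
  have h2 : ∀ h, connCoeff D d h f c x = - connCoeff D d h c f x := fun h => by
    rw [e h c f]; rfl
  simp only [h1, h2, mul_neg, Finset.sum_neg_distrib]
  ring

lemma dir_comm (hD : IsLeviCivita g D) {f : M → ℝ} (hf : ContMDiff (𝓡 4) 𝓘(ℝ, ℝ) ∞ f)
    (a b : Fin 4) (x : M) :
    dir (d.e a) (dir (d.e b) f) x - dir (d.e b) (dir (d.e a) f) x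
      = ∑ c, eta c c * (connCoeff D d a b c x - connCoeff D d b a c x) * dir (d.e c) f x := by
  rw [← dir_lie (d.smooth a) (d.smooth b) (d.smooth 0) hf x ((d.linearIndependent x).ne_zero 0)]
  have : dir (mlieBracket (𝓡 4) (d.e a) (d.e b)) f x
      = mfderiv (𝓡 4) 𝓘(ℝ, ℝ) f x (mlieBracket (𝓡 4) (d.e a) (d.e b) x) := rfl
  rw [this, lie_frame hD, map_sum]
  simp only [map_smul]
  rfl

end FrameConnection

/-! ### Bianchi identities in a frame -/

section Bianchi

variable {A : Type*} [CommRing A] [Algebra ℂ A] (δ : Fin 4 → Derivation ℂ A A)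
  (T : Fin 4 → Fin 4 → Fin 4 → A)

/-- The curvature of the connection matrices `Γ`, in a frame `δ` with structure functions `T`. -/
def curvForm {n : ℕ} (Γ : Fin 4 → Fin n → Fin n → A) (a b : Fin 4) (C D : Fin n) : A :=
  δ a (Γ b C D) - δ b (Γ a C D) + ∑ E, (Γ b C E * Γ a E D - Γ a C E * Γ b E D)
    - ∑ e, T a b e * Γ e C D

variable {δ T}

lemma jacobi_of_cyclic {W : Fin 4 → Fin 4 → Fin 4 → A}
    (hT : ∀ a b c, T a b c = W a b c - W b a c) (a b c d : Fin 4)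
    (hR : curvForm δ T W a b c d + curvForm δ T W b c a d + curvForm δ T W c a b d = 0) :
    δ a (T b c d) + δ b (T c a d) + δ c (T a b d)
      + ∑ f, (T b c f * T a f d + T c a f * T b f d + T a b f * T c f d) = 0 := by
  rw [← hR]
  simp only [curvForm, hT, map_sub, Fin.sum_univ_four]
  ring

lemma second_bianchi {Γ : Fin 4 → Fin 2 → Fin 2 → A}
    (hcomm : ∀ a b f, δ a (δ b f) - δ b (δ a f) = ∑ e, T a b e * δ e f)
    (hJ : ∀ a b c d, δ a (T b c d) + δ b (T c a d) + δ c (T a b d)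
      + ∑ f, (T b c f * T a f d + T c a f * T b f d + T a b f * T c f d) = 0)
    (a b c : Fin 4) (C D : Fin 2) :
    δ a (curvForm δ T Γ b c C D) + δ b (curvForm δ T Γ c a C D) + δ c (curvForm δ T Γ a b C D)
    + ∑ E, (curvForm δ T Γ b c C E * Γ a E D - Γ a C E * curvForm δ T Γ b c E D)
    + ∑ E, (curvForm δ T Γ c a C E * Γ b E D - Γ b C E * curvForm δ T Γ c a E D)
    + ∑ E, (curvForm δ T Γ a b C E * Γ c E D - Γ c C E * curvForm δ T Γ a b E D)
    + ∑ e, (T b c e * curvForm δ T Γ a e C D + T c a e * curvForm δ T Γ b e C D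
        + T a b e * curvForm δ T Γ c e C D) = 0 := by
  have h1 := hcomm a b (Γ c C D)
  have h2 := hcomm b c (Γ a C D)
  have h3 := hcomm c a (Γ b C D)
  have j := fun e => hJ a b c e
  simp only [Fin.sum_univ_four] at h1 h2 h3 j
  simp only [curvForm, map_add, map_sub, Derivation.leibniz, smul_eq_mul,
    Fin.sum_univ_four, Fin.sum_univ_two]
  linear_combination h1 + h2 + h3 - Γ 0 C D * j 0 - Γ 1 C D * j 1 - Γ 2 C D * j 2
    - Γ 3 C D * j 3

end Bianchi

/-! ### Two-spinor algebra of antisymmetric tensors -/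

section SpinorAlgebra

/-- The unprimed part `½ ε^{B'C'} u_{BB'CC'}` of a tensor. -/
def sdPart (u : Fin 4 → Fin 4 → ℂ) (B C : Fin 2) : ℂ :=
  (1 / 2) * ∑ B', ∑ C', eps B' C' * ∑ b, ∑ c, ivdw B B' b * ivdw C C' c * u b c

/-- The primed part `½ ε^{BC} u_{BB'CC'}` of a tensor. -/
def asdPart (u : Fin 4 → Fin 4 → ℂ) (B' C' : Fin 2) : ℂ :=
  (1 / 2) * ∑ B, ∑ C, eps B C * ∑ b, ∑ c, ivdw B B' b * ivdw C C' c * u b c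

/-- The matrix `ε^{CE} u_{BE}` of the unprimed part, acting on spinors. -/
def sdMix (u : Fin 4 → Fin 4 → ℂ) (B C : Fin 2) : ℂ := ∑ E, eps C E * sdPart u B E

/-- The symbols `√2 σ^a_{AA'}`. -/
def pauli : Fin 2 → Fin 2 → Fin 4 → ℂ :=
  ![![![1, 0, 0, 1], ![0, 1, -Complex.I, 0]], ![![0, 1, Complex.I, 0], ![1, 0, 0, -1]]]

lemma ivdw_eq (A A' : Fin 2) (a : Fin 4) :
    ivdw A A' a = (1 / (Real.sqrt 2 : ℂ)) * pauli A A' a := rfl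

lemma ivdw_mul_ivdw (A A' B B' : Fin 2) (a b : Fin 4) :
    ivdw A A' a * ivdw B B' b = (1 / 2) * (pauli A A' a * pauli B B' b) := by
  have : (1 / (Real.sqrt 2 : ℂ)) ^ 2 = 1 / 2 := by
    rw [div_pow, one_pow, ← Complex.ofReal_pow, Real.sq_sqrt (by norm_num)]
    norm_num
  rw [ivdw_eq, ivdw_eq]
  linear_combination (pauli A A' a * pauli B B' b) * this

lemma sum_eps (f : Fin 2 → Fin 2 → ℂ) : ∑ B, ∑ C, eps B C * f B C = f 0 1 - f 1 0 := by
  simp [Fin.sum_univ_two, eps]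
  ring

lemma sdPart_eq {u : Fin 4 → Fin 4 → ℂ} (h : ∀ a b, u b a = - u a b) :
    sdPart u = ![![(u 0 1 - u 1 3 - Complex.I * (u 0 2 - u 2 3)) / 2,
      -(u 0 3 + Complex.I * u 1 2) / 2],
      ![-(u 0 3 + Complex.I * u 1 2) / 2,
        (- u 0 1 - u 1 3 - Complex.I * (u 0 2 + u 2 3)) / 2]] := by
  have h0 : ∀ a, u a a = 0 := fun a => self_eq_neg.1 (h a a)
  funext B C
  unfold sdPart
  rw [sum_eps]
  simp only [ivdw_mul_ivdw]
  fin_cases B <;> fin_cases C <;>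
  simp [Fin.sum_univ_four, pauli, h0, h 0 1, h 0 2, h 0 3, h 1 2, h 1 3, h 2 3] <;> ring

lemma asdPart_eq {u : Fin 4 → Fin 4 → ℂ} (h : ∀ a b, u b a = - u a b) :
    asdPart u = ![![(u 0 1 - u 1 3 + Complex.I * (u 0 2 - u 2 3)) / 2,
      -(u 0 3 - Complex.I * u 1 2) / 2],
      ![-(u 0 3 - Complex.I * u 1 2) / 2,
        (- u 0 1 - u 1 3 + Complex.I * (u 0 2 + u 2 3)) / 2]] := by
  have h0 : ∀ a, u a a = 0 := fun a => self_eq_neg.1 (h a a)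
  funext B C
  unfold asdPart
  rw [sum_eps]
  simp only [ivdw_mul_ivdw]
  fin_cases B <;> fin_cases C <;>
  simp [Fin.sum_univ_four, pauli, h0, h 0 1, h 0 2, h 0 3, h 1 2, h 1 3, h 2 3] <;> ring

/-- The decomposition `u_{AA'BB'} = u_{AB} ε_{A'B'} + ũ_{A'B'} ε_{AB}`. -/
lemma sum_ivdw_ivdw {u : Fin 4 → Fin 4 → ℂ} (h : ∀ a b, u b a = - u a b) (A A' B B' : Fin 2) :
    ∑ a, ∑ b, ivdw A A' a * ivdw B B' b * u a b
      = eps A' B' * sdPart u A B + eps A B * asdPart u A' B' := by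
  have h0 : ∀ a, u a a = 0 := fun a => self_eq_neg.1 (h a a)
  rw [sdPart_eq h, asdPart_eq h]
  simp only [ivdw_mul_ivdw]
  fin_cases A <;> fin_cases A' <;> fin_cases B <;> fin_cases B' <;>
  simp [Fin.sum_univ_four, pauli, eps, h0, h 0 1, h 0 2, h 0 3, h 1 2, h 1 3, h 2 3] <;> ring

lemma sdMix_eq {u : Fin 4 → Fin 4 → ℂ} (h : ∀ a b, u b a = - u a b) :
    sdMix u = ![![-(u 0 3 + Complex.I * u 1 2) / 2,
      -(u 0 1 - u 1 3 - Complex.I * (u 0 2 - u 2 3)) / 2],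
      ![(- u 0 1 - u 1 3 - Complex.I * (u 0 2 + u 2 3)) / 2,
        (u 0 3 + Complex.I * u 1 2) / 2]] := by
  funext B C
  unfold sdMix
  rw [sdPart_eq h]
  fin_cases B <;> fin_cases C <;> simp [eps] <;> ring

/-- The unprimed part is a homomorphism of Lie algebras. -/
lemma sdMix_comm {u v : Fin 4 → Fin 4 → ℂ} (hu : ∀ a b, u b a = - u a b)
    (hv : ∀ a b, v b a = - v a b) (C D : Fin 2) :
    sdMix (fun c f => ∑ h, (eta h h : ℂ) * (v c h * u h f - u c h * v h f)) C D
      = ∑ E, (sdMix v C E * sdMix u E D - sdMix u C E * sdMix v E D) := by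
  have hw : ∀ a b, (fun c f => ∑ h, (eta h h : ℂ) * (v c h * u h f - u c h * v h f)) b a
      = - (fun c f => ∑ h, (eta h h : ℂ) * (v c h * u h f - u c h * v h f)) a b := by
    intro a b
    simp only [← Finset.sum_neg_distrib]
    refine Finset.sum_congr rfl fun h _ => ?_
    rw [hu h b, hu a h, hv h b, hv a h]
    ring
  have hu0 : ∀ a, u a a = 0 := fun a => self_eq_neg.1 (hu a a)
  have hv0 : ∀ a, v a a = 0 := fun a => self_eq_neg.1 (hv a a)
  rw [sdMix_eq hw, sdMix_eq hu, sdMix_eq hv]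
  fin_cases C <;> fin_cases D <;>
  simp [Fin.sum_univ_four, eta, hu0, hv0, hu 0 1, hu 0 2, hu 1 2, hu 1 3, hu 2 3,
    hv 0 1, hv 0 2, hv 1 2, hv 1 3, hv 2 3] <;> ring_nf <;>
  simp [Complex.I_sq] <;> ring

/-- A real antisymmetric tensor acts on vectors through its action on spinors. -/
lemma sum_ivdw_mul {u : Fin 4 → Fin 4 → ℝ} (hu : ∀ a b, u b a = - u a b) (v : Fin 4 → ℂ)
    (B B' : Fin 2) :
    ∑ b, ivdw B B' b * ∑ c, ((eta c c * u b c : ℝ) : ℂ) * v c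
      = ∑ E, sdMix (fun b c => (u b c : ℂ)) B E * ∑ c, ivdw E B' c * v c
        + ∑ E, (starRingEnd ℂ) (sdMix (fun b c => (u b c : ℂ)) B' E) * ∑ c, ivdw B E c * v c := by
  have hu0 : ∀ a, u a a = 0 := fun a => self_eq_neg.1 (hu a a)
  have hw : ∀ a b, (fun b c => (u b c : ℂ)) b a = - (fun b c => (u b c : ℂ)) a b := by
    intro a b; simp [hu a b]
  have h2 : (starRingEnd ℂ) 2 = 2 := map_ofNat _ 2
  rw [sdMix_eq hw]
  simp only [ivdw_eq]
  generalize (1 / (Real.sqrt 2 : ℂ)) = s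
  fin_cases B <;> fin_cases B' <;>
  simp [Fin.sum_univ_four, eta, pauli, h2, hu0, hu 0 1, hu 0 2, hu 0 3, hu 1 2, hu 1 3, hu 2 3] <;>
  ring_nf <;>
  simp [Complex.I_sq] <;> ring

end SpinorAlgebra

/-! ### The spinor decomposition of an Einstein curvature tensor -/

section CurvatureAlgebra

/-- The algebraic symmetries of a Riemann tensor with `R_{ac} = 6 L η_{ac}`. -/
structure IsEinsteinTensor (R : Fin 4 → Fin 4 → Fin 4 → Fin 4 → ℝ) (L : ℝ) : Prop where
  left : ∀ a b c f, R b a c f = - R a b c f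
  right : ∀ a b c f, R a b f c = - R a b c f
  cyclic : ∀ a b c f, R a b c f + R b c a f + R c a b f = 0
  einstein : ∀ a c, ∑ b, ∑ f, eta b f * R a b c f = 6 * L * eta a c

variable {R : Fin 4 → Fin 4 → Fin 4 → Fin 4 → ℝ} {L : ℝ}

lemma IsEinsteinTensor.pair (h : IsEinsteinTensor R L) (a b c f : Fin 4) :
    R b c a f = R a f b c := by
  linarith [h.cyclic a b c f, h.cyclic b c f a, h.cyclic c f a b, h.cyclic f a b c,
    h.right b c a f, h.right c f a b, h.right a b c f, h.right a c b f, h.left a c b f,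
    h.left b f c a, h.right b f a c, h.right f a b c, h.left a f b c]

lemma sum_eta (f : Fin 4 → Fin 4 → ℝ) :
    ∑ a, ∑ b, eta a b * f a b = f 0 0 - f 1 1 - f 2 2 - f 3 3 := by
  simp [Fin.sum_univ_four, eta]
  ring

/-- The independent components of an Einstein curvature tensor. -/
lemma IsEinsteinTensor.components (h : IsEinsteinTensor R L) :
    R 2 3 2 3 = - R 0 1 0 1 ∧ R 1 3 1 3 = - R 0 2 0 2 ∧ R 1 2 1 2 = - R 0 3 0 3 ∧
    R 0 3 0 3 = - R 0 1 0 1 - R 0 2 0 2 - 6 * L ∧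
    R 0 3 1 3 = - R 0 2 1 2 ∧ R 0 3 2 3 = R 0 1 1 2 ∧ R 0 2 2 3 = - R 0 1 1 3 ∧
    R 1 3 2 3 = R 0 1 0 2 ∧ R 1 2 2 3 = - R 0 1 0 3 ∧ R 1 2 1 3 = R 0 2 0 3 ∧
    R 0 2 1 3 = R 0 1 2 3 + R 0 3 1 2 := by
  have hE := h.einstein
  simp only [sum_eta] at hE
  have e00 := hE 0 0
  have e11 := hE 1 1
  have e22 := hE 2 2
  have e33 := hE 3 3
  have e01 := hE 0 1
  have e02 := hE 0 2
  have e03 := hE 0 3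
  have e12 := hE 1 2
  have e13 := hE 1 3
  have e23 := hE 2 3
  have c := h.cyclic 0 1 2 3
  have l0 : ∀ a c f, R a a c f = 0 := fun a c f => self_eq_neg.1 (h.left a a c f)
  have r0 : ∀ a b c, R a b c c = 0 := fun a b c => self_eq_neg.1 (h.right a b c c)
  simp [eta, l0, r0, h.left 0 1, h.left 0 2, h.left 0 3, h.left 1 2, h.left 1 3, h.left 2 3,
    fun a b => h.right a b 0 1, fun a b => h.right a b 0 2, fun a b => h.right a b 0 3,
    fun a b => h.right a b 1 2, fun a b => h.right a b 1 3, fun a b => h.right a b 2 3]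
    at e00 e11 e22 e33 e01 e02 e03 e12 e13 e23 c
  have p := h.pair 0 1 2 3
  refine ⟨?_, ?_, ?_, ?_, ?_, ?_, ?_, ?_, ?_, ?_, ?_⟩ <;> linarith

lemma sdPart_neg (u : Fin 4 → Fin 4 → ℂ) (B C : Fin 2) :
    sdPart (fun b c => - u b c) B C = - sdPart u B C := by
  simp [sdPart, Finset.sum_neg_distrib]
  ring

lemma sdPart_sub (u v : Fin 4 → Fin 4 → ℂ) (B C : Fin 2) :
    sdPart (fun b c => u b c - v b c) B C = sdPart u B C - sdPart v B C := by
  simp [sdPart, mul_sub, Finset.sum_sub_distrib]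

/-- The spinor `¼ ε^{A'B'} ε^{C'E'} R_{AA'BB'CC'EE'}`. -/
def sdCurv (R : Fin 4 → Fin 4 → Fin 4 → Fin 4 → ℝ) (A B C E : Fin 2) : ℂ :=
  sdPart (fun a b => sdPart (fun c f => (R a b c f : ℂ)) C E) A B

lemma IsEinsteinTensor.left_sd (h : IsEinsteinTensor R L) (C E : Fin 2) (a b : Fin 4) :
    sdPart (fun c f => (R b a c f : ℂ)) C E = - sdPart (fun c f => (R a b c f : ℂ)) C E := by
  rw [← sdPart_neg]
  congr 1
  funext c f
  rw [h.left a b]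
  push_cast; rfl

lemma IsEinsteinTensor.right_ofReal (h : IsEinsteinTensor R L) (a b c f : Fin 4) :
    (R a b f c : ℂ) = - (R a b c f : ℂ) := by
  rw [h.right a b]; push_cast; rfl

/-- The trace-free Ricci spinor of an Einstein tensor vanishes. -/
lemma IsEinsteinTensor.asdPart_sdPart (h : IsEinsteinTensor R L) (A' B' C E : Fin 2) :
    asdPart (fun a b => sdPart (fun c f => (R a b c f : ℂ)) C E) A' B' = 0 := by
  obtain ⟨e1, e2, e3, e4, e5, e6, e7, e8, e9, e10, e11⟩ := h.components
  rw [asdPart_eq (h.left_sd C E)]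
  simp only [sdPart_eq (h.right_ofReal _ _)]
  fin_cases A' <;> fin_cases B' <;> fin_cases C <;> fin_cases E <;>
  simp [h.pair 0 0 2 1, h.pair 0 0 3 1, h.pair 0 0 3 2, h.pair 0 1 2 1, h.pair 0 1 2 2,
    h.pair 0 1 2 3, h.pair 0 1 3 1, h.pair 0 1 3 2, h.pair 0 1 3 3, h.pair 1 1 3 2,
    h.pair 0 2 3 1, h.pair 0 2 3 2, h.pair 0 2 3 3, h.pair 1 2 3 2, h.pair 1 2 3 3, e1, e2, e3,
    e4, e5, e6, e7, e8, e9, e10, e11] <;>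
  ring_nf <;> simp [Complex.I_sq] <;> ring

lemma IsEinsteinTensor.sdCurv_symm (h : IsEinsteinTensor R 0) (A B C E : Fin 2) :
    sdCurv R A B C E = ![sdCurv R 0 0 0 0, sdCurv R 0 0 0 1, sdCurv R 0 0 1 1, sdCurv R 0 1 1 1,
      sdCurv R 1 1 1 1] ⟨A + B + C + E, by omega⟩ := by
  obtain ⟨e1, e2, e3, e4, e5, e6, e7, e8, e9, e10, e11⟩ := h.components
  unfold sdCurv
  simp only [sdPart_eq (h.left_sd _ _)]
  simp only [sdPart_eq (h.right_ofReal _ _)]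
  fin_cases A <;> fin_cases B <;> fin_cases C <;> fin_cases E <;>
  simp [h.pair 0 0 2 1, h.pair 0 0 3 1, h.pair 0 0 3 2, h.pair 0 1 2 1, h.pair 0 1 2 2,
    h.pair 0 1 2 3, h.pair 0 1 3 1, h.pair 0 1 3 2, h.pair 0 1 3 3, h.pair 1 1 3 2,
    h.pair 0 2 3 1, h.pair 0 2 3 2, h.pair 0 2 3 3, h.pair 1 2 3 2, h.pair 1 2 3 3, e1, e2, e3,
    e4, e5, e6, e7, e8, e9, e10, e11] <;>
  ring

lemma sdCurv_sub (R S : Fin 4 → Fin 4 → Fin 4 → Fin 4 → ℝ) (A B C E : Fin 2) :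
    sdCurv (fun a b c f => R a b c f - S a b c f) A B C E
      = sdCurv R A B C E - sdCurv S A B C E := by
  unfold sdCurv
  rw [← sdPart_sub]
  congr 1
  funext a b
  rw [← sdPart_sub]
  push_cast; rfl

/-- The spinor of a tensor of constant curvature. -/
lemma sdCurv_const (A B C E : Fin 2) :
    sdCurv (fun a b c f => 2 * L * (eta a c * eta b f - eta a f * eta b c)) A B C E
      = L * (eps A C * eps B E + eps A E * eps B C) := by
  have h1 : ∀ a b, ∀ c f, ((2 * L * (eta a f * eta b c - eta a c * eta b f) : ℝ) : ℂ)
      = - ((2 * L * (eta a c * eta b f - eta a f * eta b c) : ℝ) : ℂ) := by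
    intro a b c f; push_cast; ring
  have h2 : ∀ a b, sdPart (fun c f => ((2 * L * (eta b c * eta a f - eta b f * eta a c) : ℝ) : ℂ)) C E
      = - sdPart (fun c f => ((2 * L * (eta a c * eta b f - eta a f * eta b c) : ℝ) : ℂ)) C E := by
    intro a b
    rw [← sdPart_neg]
    congr 1
    funext c f; push_cast; ring
  unfold sdCurv
  rw [sdPart_eq h2]
  simp only [sdPart_eq (h1 _ _)]
  fin_cases A <;> fin_cases B <;> fin_cases C <;> fin_cases E <;>
  simp [eps, eta] <;> ring_nf <;> simp [Complex.I_sq] <;> ring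

end CurvatureAlgebra

/-! ### The algebra of smooth functions and the spin connection -/

section SmoothFunctions

variable {M : Type*} [TopologicalSpace M] [ChartedSpace (EuclideanSpace ℝ (Fin 4)) M]

variable (M) in
/-- The algebra of smooth complex functions. -/
def SmoothFun : Subalgebra ℂ (M → ℂ) where
  carrier := {f | ContMDiff (𝓡 4) 𝓘(ℝ, ℂ) ∞ f}
  mul_mem' hf hg := (contDiff_mul (𝕜 := ℝ)).contMDiff.comp (hf.prodMk_space hg)
  add_mem' hf hg := ContMDiff.add hf hg
  algebraMap_mem' _ := contMDiff_const

@[simp] lemma SmoothFun.add_apply (f h : SmoothFun M) (x : M) :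
    (f + h : SmoothFun M).1 x = f.1 x + h.1 x := rfl
@[simp] lemma SmoothFun.sub_apply (f h : SmoothFun M) (x : M) :
    (f - h : SmoothFun M).1 x = f.1 x - h.1 x := rfl
@[simp] lemma SmoothFun.mul_apply (f h : SmoothFun M) (x : M) :
    (f * h : SmoothFun M).1 x = f.1 x * h.1 x := rfl
@[simp] lemma SmoothFun.neg_apply (f : SmoothFun M) (x : M) :
    (- f : SmoothFun M).1 x = - f.1 x := rfl
@[simp] lemma SmoothFun.smul_apply (c : ℂ) (f : SmoothFun M) (x : M) :
    (c • f : SmoothFun M).1 x = c * f.1 x := rfl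
@[simp] lemma SmoothFun.zero_apply (x : M) : (0 : SmoothFun M).1 x = 0 := rfl
@[simp] lemma SmoothFun.sum_apply {ι : Type*} (s : Finset ι) (f : ι → SmoothFun M) (x : M) :
    (∑ i ∈ s, f i : SmoothFun M).1 x = ∑ i ∈ s, (f i).1 x := by
  simp

lemma SmoothFun.ext {f h : SmoothFun M} (H : ∀ x, f.1 x = h.1 x) : f = h :=
  Subtype.ext (funext H)

lemma SmoothFun.mdifferentiableAt (f : SmoothFun M) (x : M) :
    MDifferentiableAt (𝓡 4) 𝓘(ℝ, ℂ) f.1 x :=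
  (f.2 x).mdifferentiableAt (by simp)

variable [IsManifold (𝓡 4) ∞ M] {g : LorentzMetric M}

lemma frameDeriv_add (d : SpinDyad g) (a : Fin 4) (f h : SmoothFun M) (x : M) :
    frameDeriv d a (f + h : SmoothFun M).1 x = frameDeriv d a f.1 x + frameDeriv d a h.1 x := by
  have := mfderiv_add (SmoothFun.mdifferentiableAt f x) (SmoothFun.mdifferentiableAt h x)
  exact congrArg (fun l => l (d.e a x)) this

lemma frameDeriv_mul (d : SpinDyad g) (a : Fin 4) (f h : SmoothFun M) (x : M) :
    frameDeriv d a (f * h : SmoothFun M).1 x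
      = f.1 x * frameDeriv d a h.1 x + h.1 x * frameDeriv d a f.1 x := by
  have := ((SmoothFun.mdifferentiableAt f x).hasMFDerivAt.mul
    (SmoothFun.mdifferentiableAt h x).hasMFDerivAt).mfderiv
  exact congrArg (fun l => l (d.e a x)) this

lemma frameDeriv_const (d : SpinDyad g) (a : Fin 4) (c : ℂ) (x : M) :
    frameDeriv d a (fun _ => c) x = 0 := by
  unfold frameDeriv
  rw [mfderiv_const]
  rfl

/-- The derivation of the algebra of smooth functions given by a leg of the frame. -/
def frameDer (d : SpinDyad g) (a : Fin 4) : Derivation ℂ (SmoothFun M) (SmoothFun M) :=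
  Derivation.mk'
    { toFun := fun f => ⟨frameDeriv d a f.1, (d.smooth a).dir f.2⟩
      map_add' := fun f h => SmoothFun.ext fun x => frameDeriv_add d a f h x
      map_smul' := fun c f => SmoothFun.ext fun x => by
        have := frameDeriv_mul d a (algebraMap ℂ _ c) f x
        have h0 : frameDeriv d a (algebraMap ℂ (SmoothFun M) c).1 x = 0 := frameDeriv_const d a c x
        rw [h0, mul_zero, add_zero] at this
        rw [Algebra.smul_def]
        exact this }
    fun f h => SmoothFun.ext fun x => frameDeriv_mul d a f h x

@[simp] lemma frameDer_apply (d : SpinDyad g) (a : Fin 4) (f : SmoothFun M) (x : M) :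
    (frameDer d a f).1 x = frameDeriv d a f.1 x := rfl

omit [IsManifold (𝓡 4) ∞ M] in
lemma dir_clm_comp {F G : Type*} [NormedAddCommGroup F] [NormedSpace ℝ F]
    [NormedAddCommGroup G] [NormedSpace ℝ G] (l : F →L[ℝ] G) {f : M → F}
    {x : M} (hf : MDifferentiableAt (𝓡 4) 𝓘(ℝ, F) f x) (X : VField M) :
    dir X (fun y => l (f y)) x = l (dir X f x) := by
  have h : HasMFDerivAt 𝓘(ℝ, F) 𝓘(ℝ, G) l (f x) l := l.hasMFDerivAt
  have := (h.comp x hf.hasMFDerivAt).mfderiv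
  exact congrArg (fun l => l (X x)) this

lemma frameDeriv_ofReal (d : SpinDyad g) (a : Fin 4) {f : M → ℝ}
    (hf : ContMDiff (𝓡 4) 𝓘(ℝ, ℝ) ∞ f) (x : M) :
    frameDeriv d a (fun y => (f y : ℂ)) x = ((dir (d.e a) f x : ℝ) : ℂ) :=
  dir_clm_comp Complex.ofRealCLM ((hf x).mdifferentiableAt (by simp)) (d.e a)

omit [IsManifold (𝓡 4) ∞ M] in
lemma contMDiff_ofReal {f : M → ℝ} (hf : ContMDiff (𝓡 4) 𝓘(ℝ, ℝ) ∞ f) :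
    ContMDiff (𝓡 4) 𝓘(ℝ, ℂ) ∞ (fun y => (f y : ℂ)) :=
  Complex.ofRealCLM.contMDiff.comp hf

variable {D : AffineConnection M}

lemma frameDer_comm (hD : IsLeviCivita g D) (d : SpinDyad g) (a b : Fin 4) (f : SmoothFun M)
    (x : M) :
    (frameDer d a (frameDer d b f)).1 x - (frameDer d b (frameDer d a f)).1 x
      = ∑ c, ((eta c c * (connCoeff D d a b c x - connCoeff D d b a c x) : ℝ) : ℂ)
          * (frameDer d c f).1 x := by
  have hl : ∀ (l : ℂ →L[ℝ] ℝ) (c : Fin 4) (h : SmoothFun M) (y : M),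
      l ((frameDer d c h).1 y) = dir (d.e c) (fun z => l (h.1 z)) y := fun l c h y =>
    (dir_clm_comp l (SmoothFun.mdifferentiableAt h y) (d.e c)).symm
  have key : ∀ l : ℂ →L[ℝ] ℝ, l ((frameDer d a (frameDer d b f)).1 x)
      - l ((frameDer d b (frameDer d a f)).1 x)
      = ∑ c, eta c c * (connCoeff D d a b c x - connCoeff D d b a c x)
          * l ((frameDer d c f).1 x) := by
    intro l
    have h := dir_comm (d := d) hD (l.contMDiff.comp f.2) a b x
    simp only [hl]
    exact h
  apply Complex.ext
  · have := key Complex.reCLM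
    simpa using this
  · have := key Complex.imCLM
    simpa using this

end SmoothFunctions

section SpinConnection

variable {M : Type*} [TopologicalSpace M] [ChartedSpace (EuclideanSpace ℝ (Fin 4)) M]
  [IsManifold (𝓡 4) ∞ M] {g : LorentzMetric M} {D : AffineConnection M}

/-- The coefficients of the linear map `sdMix`. -/
def sdMixCoeff (B C : Fin 2) (b c : Fin 4) : ℂ :=
  ∑ E, eps C E * ((1 / 2) * ∑ B', ∑ C', eps B' C' * (ivdw B B' b * ivdw E C' c))

lemma sdMix_eq_sum (u : Fin 4 → Fin 4 → ℂ) (B C : Fin 2) :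
    sdMix u B C = ∑ b, ∑ c, sdMixCoeff B C b c * u b c := by
  simp only [sdMix, sdPart, sdMixCoeff, Fin.sum_univ_two, Finset.mul_sum,
    ← Finset.sum_add_distrib]
  refine Finset.sum_congr rfl fun b _ => Finset.sum_congr rfl fun c _ => ?_
  ring

/-- The connection coefficients as smooth functions. -/
def connFun (hD : IsLeviCivita g D) (d : SpinDyad g) (a b c : Fin 4) : SmoothFun M :=
  ⟨fun x => (connCoeff D d a b c x : ℂ), contMDiff_ofReal (connCoeff_smooth hD a b c)⟩

/-- The connection coefficients `ω_{ab}{}^c`. -/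
def connUp (hD : IsLeviCivita g D) (d : SpinDyad g) (a b c : Fin 4) : SmoothFun M :=
  (eta c c : ℂ) • connFun hD d a b c

/-- The structure functions of the frame. -/
def structFun (hD : IsLeviCivita g D) (d : SpinDyad g) (a b c : Fin 4) : SmoothFun M :=
  connUp hD d a b c - connUp hD d b a c

/-- The coefficients of the spin connection as smooth functions. -/
def spinFun (hD : IsLeviCivita g D) (d : SpinDyad g) (a : Fin 4) (B C : Fin 2) : SmoothFun M :=
  ∑ b, ∑ c, sdMixCoeff B C b c • connFun hD d a b c

variable (hD : IsLeviCivita g D) (d : SpinDyad g)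

lemma spinCoeff_eq_sdMix (a : Fin 4) (B C : Fin 2) (x : M) :
    spinCoeff D d a B C x = sdMix (fun b c => (connCoeff D d a b c x : ℂ)) B C := rfl

lemma spinFun_apply (a : Fin 4) (B C : Fin 2) (x : M) :
    (spinFun hD d a B C).1 x = spinCoeff D d a B C x := by
  rw [spinCoeff_eq_sdMix, sdMix_eq_sum]
  simp only [spinFun, SmoothFun.sum_apply, SmoothFun.smul_apply]
  rfl

lemma frameDer_connFun (a b c f : Fin 4) (x : M) :
    (frameDer d a (connFun hD d b c f)).1 x = ((dir (d.e a) (connCoeff D d b c f) x : ℝ) : ℂ) :=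
  frameDeriv_ofReal d a (connCoeff_smooth hD b c f) x

lemma structFun_apply (a b c : Fin 4) (x : M) :
    (structFun hD d a b c).1 x
      = ((eta c c * (connCoeff D d a b c x - connCoeff D d b a c x) : ℝ) : ℂ) := by
  simp [structFun, connUp, connFun]
  ring

lemma frameDer_comm_structFun (a b : Fin 4) (f : SmoothFun M) :
    frameDer d a (frameDer d b f) - frameDer d b (frameDer d a f)
      = ∑ c, structFun hD d a b c * frameDer d c f := by
  refine SmoothFun.ext fun x => ?_
  rw [SmoothFun.sub_apply, frameDer_comm hD]
  simp only [SmoothFun.sum_apply, SmoothFun.mul_apply, structFun_apply]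

lemma curvForm_connUp (a b c f : Fin 4) (x : M) :
    (curvForm (frameDer d) (structFun hD d) (connUp hD d) a b c f).1 x
      = (eta f f : ℂ) * (riemann D d a b c f x : ℂ) := by
  rw [riemann_eq hD]
  have h : ∀ a b c, (connUp hD d a b c).1 x = (eta c c : ℂ) * (connCoeff D d a b c x : ℂ) :=
    fun _ _ _ => rfl
  have h' : ∀ a b, (frameDer d a (connUp hD d b c f)).1 x
      = (eta f f : ℂ) * ((dir (d.e a) (connCoeff D d b c f) x : ℝ) : ℂ) := by
    intro a b
    rw [connUp, Derivation.map_smul, SmoothFun.smul_apply, frameDer_connFun]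
  simp only [curvForm, SmoothFun.sub_apply, SmoothFun.add_apply,
    SmoothFun.sum_apply, SmoothFun.mul_apply, h, h', structFun_apply]
  push_cast
  simp only [Fin.sum_univ_four]
  ring

lemma structFun_jacobi (a b c f : Fin 4) :
    frameDer d a (structFun hD d b c f) + frameDer d b (structFun hD d c a f)
      + frameDer d c (structFun hD d a b f)
      + ∑ h, (structFun hD d b c h * structFun hD d a h f
        + structFun hD d c a h * structFun hD d b h f
        + structFun hD d a b h * structFun hD d c h f) = 0 := by
  refine jacobi_of_cyclic (T := structFun hD d) (W := connUp hD d) (fun _ _ _ => rfl) a b c f ?_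
  refine SmoothFun.ext fun x => ?_
  simp only [SmoothFun.add_apply, curvForm_connUp, SmoothFun.zero_apply, ← mul_add]
  rw [← Complex.ofReal_add, ← Complex.ofReal_add, riemann_cyclic hD]
  simp

/-- The curvature of the spin connection is the unprimed part of the Riemann tensor. -/
lemma curvForm_spinFun (a b : Fin 4) (B C : Fin 2) (x : M) :
    (curvForm (frameDer d) (structFun hD d) (spinFun hD d) a b B C).1 x
      = sdMix (fun c f => (riemann D d a b c f x : ℂ)) B C := by
  have hu : ∀ a b c, (connCoeff D d a c b x : ℂ) = - (connCoeff D d a b c x : ℂ) := by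
    intro a b c
    rw [connCoeff_antisymm hD]; push_cast; rfl
  have hq := sdMix_comm (u := fun b c => (connCoeff D d a b c x : ℂ))
    (v := fun b' c => (connCoeff D d b b' c x : ℂ)) (hu a) (hu b) B C
  have hder : ∀ a b, (frameDer d a (spinFun hD d b B C)).1 x
      = ∑ c, ∑ f, sdMixCoeff B C c f * ((dir (d.e a) (connCoeff D d b c f) x : ℝ) : ℂ) := by
    intro a b
    simp only [spinFun, map_sum, Derivation.map_smul, SmoothFun.sum_apply, SmoothFun.smul_apply,
      frameDer_connFun]
  simp only [curvForm, SmoothFun.sub_apply, SmoothFun.add_apply, SmoothFun.sum_apply,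
    SmoothFun.mul_apply, hder, structFun_apply, spinFun_apply, spinCoeff_eq_sdMix]
  rw [← hq]
  have hT : ∀ (t : Fin 4 → ℂ) (u : Fin 4 → Fin 4 → Fin 4 → ℂ),
      ∑ e, t e * ∑ c, ∑ f, sdMixCoeff B C c f * u e c f
        = ∑ c, ∑ f, sdMixCoeff B C c f * ∑ e, t e * u e c f := by
    intro t u
    simp only [Finset.mul_sum]
    rw [Finset.sum_comm]
    refine Finset.sum_congr rfl fun c _ => ?_
    rw [Finset.sum_comm]
    exact Finset.sum_congr rfl fun f _ => Finset.sum_congr rfl fun e _ => by ring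
  simp only [sdMix_eq_sum, hT, ← Finset.sum_sub_distrib, ← Finset.sum_add_distrib]
  refine Finset.sum_congr rfl fun c _ => Finset.sum_congr rfl fun f _ => ?_
  rw [riemann_eq hD]
  push_cast
  ring

end SpinConnection

/-! ### The null frame -/

section Contraction

variable {V : Type*} [AddCommGroup V] [Module ℂ V]

/-- The contraction `σ^a_{AA'} f_a`. -/
def contr (A A' : Fin 2) (f : Fin 4 → V) : V := ∑ a, ivdw A A' a • f a

variable (A A' B B' : Fin 2)

lemma contr_add (f h : Fin 4 → V) :
    contr A A' (fun a => f a + h a) = contr A A' f + contr A A' h := by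
  simp [contr, Finset.sum_add_distrib]

lemma contr_sub (f h : Fin 4 → V) :
    contr A A' (fun a => f a - h a) = contr A A' f - contr A A' h := by
  simp [contr, smul_sub, Finset.sum_sub_distrib]

lemma contr_sum {ι : Type*} (s : Finset ι) (f : ι → Fin 4 → V) :
    contr A A' (fun a => ∑ i ∈ s, f i a) = ∑ i ∈ s, contr A A' (f i) := by
  simp only [contr, Finset.smul_sum]
  rw [Finset.sum_comm]

lemma contr_zero : contr A A' (fun _ => (0 : V)) = 0 := by simp [contr]

lemma contr_comm (f : Fin 4 → Fin 4 → V) :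
    contr A A' (fun a => contr B B' (f a)) = contr B B' (fun b => contr A A' (fun a => f a b)) := by
  simp only [contr, Finset.smul_sum]
  rw [Finset.sum_comm]
  exact Finset.sum_congr rfl fun _ _ => Finset.sum_congr rfl fun _ _ => smul_comm _ _ _

variable {R : Type*} [CommRing R] [Algebra ℂ R]

lemma contr_mul (f : Fin 4 → R) (r : R) : contr A A' (fun a => f a * r) = contr A A' f * r := by
  simp [contr, Finset.sum_mul]

lemma mul_contr (f : Fin 4 → R) (r : R) : contr A A' (fun a => r * f a) = r * contr A A' f := by
  simp [contr, Finset.mul_sum]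

lemma contr_map (l : Derivation ℂ R R) (f : Fin 4 → R) :
    l (contr A A' f) = contr A A' (fun a => l (f a)) := by
  simp [contr, map_sum]

lemma contr_derivation_apply (l : Fin 4 → Derivation ℂ R R) (f : R) :
    contr A A' l f = contr A A' (fun a => l a f) := by
  simp only [contr, Fin.sum_univ_four]
  rfl

end Contraction

section NullFrame

variable {M : Type*} [TopologicalSpace M] [ChartedSpace (EuclideanSpace ℝ (Fin 4)) M]
  [IsManifold (𝓡 4) ∞ M] {g : LorentzMetric M} {D : AffineConnection M}

omit [IsManifold (𝓡 4) ∞ M] in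
lemma contr_apply (A A' : Fin 2) (f : Fin 4 → SmoothFun M) (x : M) :
    (contr A A' f).1 x = ∑ a, ivdw A A' a * (f a).1 x := by
  simp only [contr, SmoothFun.sum_apply, SmoothFun.smul_apply]

omit [IsManifold (𝓡 4) ∞ M] in
/-- The complex conjugate of a smooth function. -/
def conjFun (f : SmoothFun M) : SmoothFun M :=
  ⟨fun x => (starRingEnd ℂ) (f.1 x),
    (Complex.conjCLE.toContinuousLinearMap.contMDiff (n := ∞)).comp f.2⟩

/-- The directional derivative `∂_{AA'}`. -/
def nullDer (d : SpinDyad g) (A A' : Fin 2) : Derivation ℂ (SmoothFun M) (SmoothFun M) :=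
  contr A A' (frameDer d)

variable (hD : IsLeviCivita g D) (d : SpinDyad g)

/-- The spin coefficients `Γ_{AA'B}{}^C`. -/
def nullSpin (A A' B C : Fin 2) : SmoothFun M := contr A A' (fun a => spinFun hD d a B C)

/-- The conjugate spin coefficients `Γ̄_{AA'B'}{}^{C'}`. -/
def nullSpinConj (A A' B' C' : Fin 2) : SmoothFun M :=
  contr A A' (fun a => conjFun (spinFun hD d a B' C'))

/-- The curvature `F_{AA'BB'C}{}^D` of the spin connection. -/
def nullCurv (A A' B B' C E : Fin 2) : SmoothFun M :=
  contr A A' fun a => contr B B' fun b =>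
    curvForm (frameDer d) (structFun hD d) (spinFun hD d) a b C E

/-- The torsion part of the commutator of `∂_{AA'}` and `∂_{BB'}`, applied to `v`. -/
def nullTorsion (A A' B B' : Fin 2) (v : Fin 2 → Fin 2 → SmoothFun M) : SmoothFun M :=
  ∑ E, nullSpin hD d A A' B E * v E B' + ∑ E, nullSpinConj hD d A A' B' E * v B E
    - ∑ E, nullSpin hD d B B' A E * v E A' - ∑ E, nullSpinConj hD d B B' A' E * v A E

lemma contr_connUp (A A' B B' : Fin 2) (v : Fin 4 → SmoothFun M) :
    (contr A A' fun a => contr B B' fun b => ∑ c, connUp hD d a b c * v c)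
      = ∑ E, nullSpin hD d A A' B E * contr E B' v
        + ∑ E, nullSpinConj hD d A A' B' E * contr B E v := by
  have key : ∀ a, (contr B B' fun b => ∑ c, connUp hD d a b c * v c)
      = ∑ E, spinFun hD d a B E * contr E B' v
        + ∑ E, conjFun (spinFun hD d a B' E) * contr B E v := by
    intro a
    refine SmoothFun.ext fun x => ?_
    have h := sum_ivdw_mul (u := fun b c => connCoeff D d a b c x)
      (fun b c => connCoeff_antisymm hD a b c x) (fun c => (v c).1 x) B B'
    have h2 : ∀ b c, (connUp hD d a b c).1 x = ((eta c c * connCoeff D d a b c x : ℝ) : ℂ) := by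
      intro b c
      push_cast
      rfl
    have h3 : ∀ B C, (conjFun (spinFun hD d a B C)).1 x
        = (starRingEnd ℂ) (spinCoeff D d a B C x) := by
      intro B C
      rw [← spinFun_apply hD]
      rfl
    simp only [contr_apply, SmoothFun.sum_apply, SmoothFun.mul_apply, SmoothFun.add_apply, h2, h3,
      spinFun_apply]
    exact h
  simp only [key, contr_add, contr_sum, contr_mul]
  rfl

lemma contr_structFun (A A' B B' : Fin 2) (v : Fin 4 → SmoothFun M) :
    (contr A A' fun a => contr B B' fun b => ∑ c, structFun hD d a b c * v c)
      = nullTorsion hD d A A' B B' (fun E E' => contr E E' v) := by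
  have h1 := contr_connUp hD d A A' B B' v
  have h2 := contr_connUp hD d B B' A A' v
  rw [contr_comm] at h2
  simp only [structFun, sub_mul, Finset.sum_sub_distrib, contr_sub]
  rw [h1, h2, nullTorsion]
  ring

lemma nullDer_comm (A A' B B' : Fin 2) (f : SmoothFun M) :
    nullDer d A A' (nullDer d B B' f) - nullDer d B B' (nullDer d A A' f)
      = nullTorsion hD d A A' B B' (fun E E' => nullDer d E E' f) := by
  simp only [nullDer, contr_derivation_apply, contr_map]
  rw [contr_comm B B' A A', ← contr_structFun, ← contr_sub]
  congr 1; funext a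
  rw [← contr_sub]
  congr 1; funext b
  exact frameDer_comm_structFun hD d a b f

/-- The structure equation of the spin connection. -/
lemma nullCurv_eq (A A' B B' C E : Fin 2) :
    nullCurv hD d A A' B B' C E
      = nullDer d A A' (nullSpin hD d B B' C E) - nullDer d B B' (nullSpin hD d A A' C E)
        + ∑ P, (nullSpin hD d B B' C P * nullSpin hD d A A' P E
          - nullSpin hD d A A' C P * nullSpin hD d B B' P E)
        - nullTorsion hD d A A' B B' (fun F F' => nullSpin hD d F F' C E) := by
  have h := contr_structFun hD d A A' B B' (fun c => spinFun hD d c C E)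
  simp only [contr_sum, contr_mul] at h
  simp only [nullCurv, curvForm, contr_sub, contr_add, contr_sum]
  simp only [nullDer, nullSpin, contr_derivation_apply, contr_map]
  rw [contr_comm B B' A A']
  simp only [contr_mul, mul_contr]
  rw [h]

/-- One of the three cyclic terms of the Bianchi identity. -/
def bianchiTerm (A A' B B' C C' P Q : Fin 2) : SmoothFun M :=
  nullDer d A A' (nullCurv hD d B B' C C' P Q)
    + ∑ E, (nullCurv hD d B B' C C' P E * nullSpin hD d A A' E Q
      - nullSpin hD d A A' P E * nullCurv hD d B B' C C' E Q)
    + nullTorsion hD d B B' C C' (fun E E' => nullCurv hD d A A' E E' P Q)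

lemma bianchiTerm_eq (A A' B B' C C' P Q : Fin 2) :
    bianchiTerm hD d A A' B B' C C' P Q
      = contr A A' fun a => contr B B' fun b => contr C C' fun c =>
        (frameDer d a (curvForm (frameDer d) (structFun hD d) (spinFun hD d) b c P Q)
        + ∑ E, (curvForm (frameDer d) (structFun hD d) (spinFun hD d) b c P E * spinFun hD d a E Q
          - spinFun hD d a P E * curvForm (frameDer d) (structFun hD d) (spinFun hD d) b c E Q)
        + ∑ e, structFun hD d b c e *
          curvForm (frameDer d) (structFun hD d) (spinFun hD d) a e P Q) := by
  have h : ∀ v : Fin 4 → Fin 4 → SmoothFun M,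
      nullTorsion hD d B B' C C' (fun E E' => contr A A' fun a => contr E E' (v a))
      = contr A A' fun a => nullTorsion hD d B B' C C' (fun E E' => contr E E' (v a)) := by
    intro v
    simp only [nullTorsion, contr_sub, contr_add, contr_sum, mul_contr]
  simp only [bianchiTerm, nullCurv, h]
  simp only [contr_add, contr_sum, contr_sub, mul_contr, contr_mul, ← contr_structFun, nullDer,
    contr_derivation_apply, contr_map, nullSpin]
  congr 2
  rw [contr_comm A A' B B']
  congr 1; funext b
  rw [contr_comm A A' C C']

lemma null_bianchi (A A' B B' C C' P Q : Fin 2) :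
    bianchiTerm hD d A A' B B' C C' P Q + bianchiTerm hD d B B' C C' A A' P Q
      + bianchiTerm hD d C C' A A' B B' P Q = 0 := by
  have hB := second_bianchi (Γ := spinFun hD d) (frameDer_comm_structFun hD d)
    (structFun_jacobi hD d)
  rw [bianchiTerm_eq, bianchiTerm_eq, bianchiTerm_eq]
  have e2 : ∀ f : Fin 4 → Fin 4 → Fin 4 → SmoothFun M,
      (contr B B' fun b => contr C C' fun c => contr A A' fun a => f b c a)
      = contr A A' fun a => contr B B' fun b => contr C C' fun c => f b c a := by
    intro f
    rw [contr_comm A A' B B']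
    congr 1; funext b
    rw [contr_comm C C' A A']
  have e3 : ∀ f : Fin 4 → Fin 4 → Fin 4 → SmoothFun M,
      (contr C C' fun c => contr A A' fun a => contr B B' fun b => f c a b)
      = contr A A' fun a => contr B B' fun b => contr C C' fun c => f c a b := by
    intro f
    rw [contr_comm C C' A A']
    congr 1; funext b
    rw [contr_comm C C' B B']
  rw [e2, e3, ← contr_add, ← contr_add, ← contr_zero A A']
  congr 1; funext a
  rw [← contr_add, ← contr_add, ← contr_zero B B']
  congr 1; funext b
  rw [← contr_add, ← contr_add, ← contr_zero C C']
  congr 1; funext c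
  rw [← hB a b c P Q]
  simp only [Finset.sum_add_distrib]
  ring

end NullFrame

/-! ### Formal spinor calculus in a null frame -/

section SpinCalculus

/-- A null frame of derivations `∂_{AA'}` with spin coefficients `Γ_{AA'B}{}^C` and
`Γ̄_{AA'B'}{}^{C'}`. -/
structure SpinFrame (R : Type*) [CommRing R] [Algebra ℂ R] where
  der : Fin 2 → Fin 2 → Derivation ℂ R R
  coeff : Fin 2 → Fin 2 → Fin 2 → Fin 2 → R
  coeffConj : Fin 2 → Fin 2 → Fin 2 → Fin 2 → R

namespace SpinFrame

variable {R : Type*} [CommRing R] [Algebra ℂ R] (S : SpinFrame R)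

/-- The torsion part of the commutator of `∂_{AA'}` and `∂_{BB'}`, applied to `v`. -/
def torsion (A A' B B' : Fin 2) (v : Fin 2 → Fin 2 → R) : R :=
  ∑ E, S.coeff A A' B E * v E B' + ∑ E, S.coeffConj A A' B' E * v B E
    - ∑ E, S.coeff B B' A E * v E A' - ∑ E, S.coeffConj B B' A' E * v A E

/-- The curvature of the spin connection. -/
def curv (A A' B B' C E : Fin 2) : R :=
  S.der A A' (S.coeff B B' C E) - S.der B B' (S.coeff A A' C E)
    + ∑ P, (S.coeff B B' C P * S.coeff A A' P E - S.coeff A A' C P * S.coeff B B' P E)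
    - S.torsion A A' B B' (fun F F' => S.coeff F F' C E)

/-- The frame is torsion-free and the spin connection preserves `ε_{AB}`. -/
structure IsTorsionFree : Prop where
  trace : ∀ A A', S.coeff A A' 1 1 = - S.coeff A A' 0 0
  traceConj : ∀ A A', S.coeffConj A A' 1 1 = - S.coeffConj A A' 0 0
  comm : ∀ A A' B B' f, S.der A A' (S.der B B' f) - S.der B B' (S.der A A' f)
    = S.torsion A A' B B' (fun E E' => S.der E E' f)

/-- The components `∇_{AA'} K_{BC}`. -/
def nabla2 (K : Fin 2 → Fin 2 → R) (A A' B C : Fin 2) : R :=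
  S.der A A' (K B C) - ∑ E, S.coeff A A' B E * K E C - ∑ E, S.coeff A A' C E * K B E

/-- The components `∇_{AA'} ξ_{BB'}`. -/
def nablaVec (xi : Fin 2 → Fin 2 → R) (A A' B B' : Fin 2) : R :=
  S.der A A' (xi B B') - ∑ E, S.coeff A A' B E * xi E B' - ∑ E, S.coeffConj A A' B' E * xi B E

/-- The components `∇_{DD'} N_{AA'BC}`. -/
def nabla4 (N : Fin 2 → Fin 2 → Fin 2 → Fin 2 → R) (D D' A A' B C : Fin 2) : R :=
  S.der D D' (N A A' B C) - ∑ E, S.coeff D D' A E * N E A' B C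
    - ∑ E, S.coeffConj D D' A' E * N A E B C - ∑ E, S.coeff D D' B E * N A A' E C
    - ∑ E, S.coeff D D' C E * N A A' B E

/-- The divergence `∇^B{}_{A'} K_{AB}`. -/
def divK (K : Fin 2 → Fin 2 → R) (A A' : Fin 2) : R :=
  S.nabla2 K 1 A' A 0 - S.nabla2 K 0 A' A 1

variable {S}

/-- The Ricci identity for a symmetric spinor. -/
lemma IsTorsionFree.ricci (hS : S.IsTorsionFree) (K : Fin 2 → Fin 2 → R) (D D' A A' B C : Fin 2) :
    S.nabla4 (S.nabla2 K) D D' A A' B C - S.nabla4 (S.nabla2 K) A A' D D' B C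
      = - ∑ E, S.curv D D' A A' B E * K E C - ∑ E, S.curv D D' A A' C E * K B E := by
  have h := hS.comm D D' A A' (K B C)
  simp only [torsion, Fin.sum_univ_two] at h
  simp only [nabla4, nabla2, curv, torsion, Fin.sum_univ_two, map_sub, map_add,
    Derivation.leibniz, smul_eq_mul]
  linear_combination h

lemma IsTorsionFree.nablaVec_divK (hS : S.IsTorsionFree) (K : Fin 2 → Fin 2 → R)
    (A A' B B' : Fin 2) :
    S.nablaVec (S.divK K) A A' B B'
      = S.nabla4 (S.nabla2 K) A A' 1 B' B 0 - S.nabla4 (S.nabla2 K) A A' 0 B' B 1 := by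
  simp only [nabla4, nablaVec, divK, Fin.sum_univ_two, map_sub, hS.trace]
  ring

/-- If `o` is geodesic and shear-free and `∇_{A'(A} K_{BC)}` is proportional to `o_A o_B o_C`, then
the divergence of `K` solves the Killing equation projected along `o`. -/
theorem IsTorsionFree.projected_killing (hS : S.IsTorsionFree)
    {X : Fin 2 → Fin 2 → Fin 2 → Fin 2 → R}
    (hF0 : ∀ A A' B C E, S.curv A A' B A' C E = 0)
    (hF1 : ∀ A B C E, S.curv A 0 B 1 C E = X A B C E)
    (hF2 : ∀ A B C E, S.curv A 1 B 0 C E = - X A B C E)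
    (hX1 : X 0 1 0 1 = 0) (hX2 : X 0 1 1 1 = - X 0 1 0 0)
    (hgs : ∀ A', S.coeff 0 A' 0 1 = 0)
    {K : Fin 2 → Fin 2 → R} (hK0 : K 0 0 = 0) (hK : K 1 0 = K 0 1)
    (h0 : ∀ A', S.nabla2 K 0 A' 0 0 = 0)
    (h1 : ∀ A', 2 * S.nabla2 K 0 A' 0 1 + S.nabla2 K 1 A' 0 0 = 0)
    (h2 : ∀ A', S.nabla2 K 0 A' 1 1 + 2 * S.nabla2 K 1 A' 0 1 = 0) (A' B B' : Fin 2) :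
    2 * (S.nablaVec (S.divK K) 0 A' B B' + S.nablaVec (S.divK K) B B' 0 A') = 0 := by
  have hsym : ∀ A A', S.nabla2 K A A' 1 0 = S.nabla2 K A A' 0 1 := by
    intro A A'
    simp only [nabla2, Fin.sum_univ_two, hK]
    ring
  set N := S.nabla2 K with hN
  have hsym4 : ∀ D D' A A', S.nabla4 N D D' A A' 1 0 = S.nabla4 N D D' A A' 0 1 := by
    intro D D' A A'
    simp only [nabla4, Fin.sum_univ_two, hsym]
    ring
  have z1 : ∀ D D' A', S.nabla4 N D D' 0 A' 0 0 = 0 := by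
    intro D D' A'
    simp only [nabla4, Fin.sum_univ_two, hsym, h0, map_zero]
    linear_combination - S.coeff D D' 0 1 * h1 A'
  have z2 : ∀ D D' A', 2 * S.nabla4 N D D' 0 A' 0 1 + S.nabla4 N D D' 1 A' 0 0 = 0 := by
    intro D D' A'
    have e := congrArg (S.der D D') (h1 A')
    simp only [two_mul, map_add, map_zero] at e
    simp only [nabla4, Fin.sum_univ_two, hsym]
    linear_combination e - (S.coeff D D' 0 0 * 2 + S.coeff D D' 1 1) * h1 A'
      - S.coeffConj D D' A' 0 * h1 0 - S.coeffConj D D' A' 1 * h1 1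
      - 2 * S.coeff D D' 0 1 * h2 A' - 3 * S.coeff D D' 1 0 * h0 A'
  have z3 : ∀ D' A', S.nabla4 N 0 D' 0 A' 1 1 + 2 * S.nabla4 N 0 D' 1 A' 0 1 = 0 := by
    intro D' A'
    have e := congrArg (S.der 0 D') (h2 A')
    simp only [two_mul, map_add, map_zero] at e
    simp only [nabla4, Fin.sum_univ_two, hsym, hgs]
    linear_combination e - (S.coeff 0 D' 0 0 + 2 * S.coeff 0 D' 1 1) * h2 A'
      - S.coeffConj 0 D' A' 0 * h2 0 - S.coeffConj 0 D' A' 1 * h2 1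
      - 2 * S.coeff 0 D' 1 0 * h1 A'
  rw [hS.nablaVec_divK, hS.nablaVec_divK]
  have ric := hS.ricci K
  rw [← hN] at ric ⊢
  have fb : ∀ A' B', S.curv 0 A' 1 B' 0 1 = 0 := by
    intro A' B'
    fin_cases A' <;> fin_cases B' <;> simp [hF0, hF1, hF2, hX1]
  have fc : ∀ A' B', S.curv 0 A' 1 B' 1 1 = - S.curv 0 A' 1 B' 0 0 := by
    intro A' B'
    fin_cases A' <;> fin_cases B' <;> simp [hF0, hF1, hF2, hX2]
  match B with
  | 0 =>
    have r1 := ric 0 A' 1 B' 0 0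
    have r2 := ric 0 B' 1 A' 0 0
    simp only [Fin.sum_univ_two, z1, hK0, fb] at r1 r2
    linear_combination 3 * r1 + 3 * r2 - z2 0 A' B' - z2 0 B' A'
  | 1 =>
    have r1 := ric 0 A' 1 B' 0 1
    simp only [Fin.sum_univ_two, hK0, fb, fc] at r1
    rw [hsym4]
    linear_combination 6 * r1 - 2 * z3 A' B' + 2 * z2 1 B' A'

end SpinFrame
end SpinCalculus

section TypeIIField

namespace SpinFrame

variable {R : Type*} [CommRing R] [Algebra ℂ R] (S : SpinFrame R)

/-- One of the three cyclic terms of the Bianchi identity. -/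
def bianchiTerm (A A' B B' C C' P Q : Fin 2) : R :=
  S.der A A' (S.curv B B' C C' P Q)
    + ∑ E, (S.curv B B' C C' P E * S.coeff A A' E Q - S.coeff A A' P E * S.curv B B' C C' E Q)
    + S.torsion B B' C C' (fun E E' => S.curv A A' E E' P Q)

/-- The curvature spinor `X_{ABC}{}^E = Ψ_{ABC}{}^E + Λ-terms` with `Ψ₀ = Ψ₁ = 0`. -/
def typeIICurv (p₂ p₃ p₄ L : R) : Fin 2 → Fin 2 → Fin 2 → Fin 2 → R :=
  ![![![![0, 0], ![p₂ + 2 * L, 0]], ![![p₂ - L, 0], ![p₃, L - p₂]]],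
    ![![![p₂ - L, 0], ![p₃, L - p₂]], ![![p₃, -(p₂ + 2 * L)], ![p₄, - p₃]]]]

/-- The curvature is that of an Einstein space of type II. -/
structure IsTypeIIEinstein (p₂ p₃ p₄ L : R) : Prop extends S.IsTorsionFree where
  bianchi : ∀ A A' B B' C C' P Q, S.bianchiTerm A A' B B' C C' P Q
    + S.bianchiTerm B B' C C' A A' P Q + S.bianchiTerm C C' A A' B B' P Q = 0
  curv_same : ∀ A A' B C E, S.curv A A' B A' C E = 0
  curv_zero_one : ∀ A B C E, S.curv A 0 B 1 C E = typeIICurv p₂ p₃ p₄ L A B C E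
  curv_one_zero : ∀ A B C E, S.curv A 1 B 0 C E = - typeIICurv p₂ p₃ p₄ L A B C E
  der_const : ∀ A A', S.der A A' L = 0

variable {S} {p₂ p₃ p₄ L : R}

lemma IsTypeIIEinstein.bianchi_zero (h : S.IsTypeIIEinstein p₂ p₃ p₄ L) (A' : Fin 2) :
    3 * p₂ * S.coeff 0 A' 0 1 = 0 := by
  have hB := h.bianchi 0 0 0 1 1 A' 0 1
  fin_cases A' <;>
  simp [bianchiTerm, torsion, h.curv_same, h.curv_zero_one, h.curv_one_zero, typeIICurv,
    h.trace] at hB ⊢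
  · linear_combination -hB
  · linear_combination -hB

lemma IsTypeIIEinstein.bianchi_one (h : S.IsTypeIIEinstein p₂ p₃ p₄ L) (A' : Fin 2) :
    S.der 0 A' p₂ = - 3 * S.coeff 1 A' 0 1 * p₂ + 2 * S.coeff 0 A' 0 1 * p₃ := by
  have hB := h.bianchi 0 0 0 1 1 A' 0 0
  fin_cases A' <;>
  simp [bianchiTerm, torsion, h.curv_same, h.curv_zero_one, h.curv_one_zero, typeIICurv,
    h.der_const, h.trace, h.traceConj] at hB ⊢
  · linear_combination -hB
  · linear_combination -hB

lemma IsTypeIIEinstein.bianchi_two (h : S.IsTypeIIEinstein p₂ p₃ p₄ L) (A' : Fin 2) :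
    S.der 1 A' p₂ - 2 * S.coeff 1 A' 0 1 * p₃
      = S.der 0 A' p₃ + 2 * S.coeff 0 A' 0 0 * p₃ - S.coeff 0 A' 0 1 * p₄
        - 3 * S.coeff 0 A' 1 0 * p₂ := by
  have hB := h.bianchi 0 0 0 1 1 A' 1 0
  fin_cases A' <;>
  simp [bianchiTerm, torsion, h.curv_same, h.curv_zero_one, h.curv_one_zero, typeIICurv,
    h.der_const, h.trace, h.traceConj, two_mul] at hB ⊢
  · linear_combination hB
  · linear_combination hB

/-- The rescaled spinor `φ⁻¹ o_{(A} ι_{B)} - (1/3) φ⁻⁴ Ψ₃ o_A o_B` generates a projected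
Killing vector. -/
theorem IsTypeIIEinstein.projected_killing (h : S.IsTypeIIEinstein p₂ p₃ p₄ L) {φ ψ : R}
    (hφ : φ * φ * φ = p₂) (hψ : φ * ψ = 1) {K : Fin 2 → Fin 2 → R} (hK0 : K 0 0 = 0)
    (hK : K 1 0 = K 0 1) (hK1 : 2 * K 0 1 = - ψ) (hK2 : 3 * K 1 1 = - (ψ * ψ * ψ * ψ) * p₃)
    (A' B B' : Fin 2) :
    2 * (S.nablaVec (S.divK K) 0 A' B B' + S.nablaVec (S.divK K) B B' 0 A') = 0 := by
  obtain ⟨t, ht⟩ : ∃ t : R, 3 * t = 1 :=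
    ⟨algebraMap ℂ R (1 / 3), by rw [← map_ofNat (algebraMap ℂ R) 3, ← map_mul]; norm_num⟩
  have cancel : ∀ r : R, 3 * r = 0 → r = 0 := by
    intro r hr
    linear_combination t * hr - r * ht
  have hp : ψ * ψ * ψ * p₂ = 1 := by
    rw [← hφ]
    linear_combination (1 + φ * ψ + (φ * ψ) ^ 2) * hψ
  have hgs : ∀ A', S.coeff 0 A' 0 1 = 0 := by
    intro A'
    refine cancel _ ?_
    linear_combination ψ * ψ * ψ * h.bianchi_zero A' - 3 * S.coeff 0 A' 0 1 * hp
  have hder : ∀ A A', 3 * S.der A A' ψ = - (ψ * ψ * ψ * ψ) * S.der A A' p₂ := by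
    intro A A'
    have e1 := congrArg (S.der A A') hψ
    simp only [Derivation.leibniz, smul_eq_mul, Derivation.map_one_eq_zero] at e1
    rw [← hφ]
    simp only [Derivation.leibniz, smul_eq_mul]
    linear_combination 3 * ψ * e1 - 3 * (S.der A A' ψ - S.der A A' φ * ψ ^ 2 * (1 + φ * ψ)) * hψ
  have hb1 : ∀ A', S.der 0 A' ψ = S.coeff 1 A' 0 1 * ψ := by
    intro A'
    have e := h.bianchi_one A'
    rw [hgs] at e
    refine sub_eq_zero.1 (cancel _ ?_)
    linear_combination hder 0 A' - ψ * ψ * ψ * ψ * e + 3 * S.coeff 1 A' 0 1 * ψ * hp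
  have dK1 : ∀ A A', 2 * S.der A A' (K 0 1) = - S.der A A' ψ := by
    intro A A'
    rw [← map_neg, ← hK1, two_mul, two_mul, map_add]
  have dK2 : ∀ A A', 3 * S.der A A' (K 1 1) = - (ψ * ψ * ψ * ψ) * S.der A A' p₃
      - 4 * ψ * ψ * ψ * p₃ * S.der A A' ψ := by
    intro A A'
    have e := congrArg (S.der A A') hK2
    have h3 : (3 : R) * K 1 1 = K 1 1 + K 1 1 + K 1 1 := by ring
    rw [h3] at e
    simp only [neg_mul, map_neg, map_add, Derivation.leibniz, smul_eq_mul] at e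
    linear_combination e
  refine h.toIsTorsionFree.projected_killing h.curv_same h.curv_zero_one h.curv_one_zero
    (by simp [typeIICurv]) (by simp [typeIICurv]) hgs hK0 hK ?_ ?_ ?_ A' B B'
  · intro A'
    simp [nabla2, hK0, hgs]
  · intro A'
    simp only [nabla2, Fin.sum_univ_two, hK0, hK, hgs, h.trace, map_zero]
    linear_combination dK1 0 A' - hb1 A' - S.coeff 1 A' 0 1 * hK1
  · intro A'
    refine cancel _ ?_
    have e := h.bianchi_two A'
    rw [hgs] at e
    simp only [nabla2, Fin.sum_univ_two, hK0, hK, h.trace]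
    linear_combination dK2 0 A' + 3 * dK1 1 A' - hder 1 A' - 3 * S.coeff 0 A' 1 0 * hK1
      + (2 * S.coeff 0 A' 0 0 - 2 * S.coeff 1 A' 0 1) * hK2 - 4 * ψ * ψ * ψ * p₃ * hb1 A'
      + ψ * ψ * ψ * ψ * e - 3 * S.coeff 0 A' 1 0 * ψ * hp

end SpinFrame
end TypeIIField

section EinsteinTypeII

variable {M : Type*} [TopologicalSpace M] [ChartedSpace (EuclideanSpace ℝ (Fin 4)) M]
  [IsManifold (𝓡 4) ∞ M] {g : LorentzMetric M} {D : AffineConnection M}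

/-! ### The curvature of an Einstein metric of type II -/

lemma isEinsteinTensor_riemann (hD : IsLeviCivita g D) {d : SpinDyad g} {L : ℝ}
    (hL : ∀ a b x, ricci D d a b x = 6 * L * eta a b) (x : M) :
    IsEinsteinTensor (fun a b c f => riemann D d a b c f x) L where
  left a b c f := riemann_antisymm_left a b c f x
  right a b c f := riemann_antisymm_right hD a b c f x
  cyclic a b c f := riemann_cyclic hD a b c f x
  einstein a c := hL a c x

lemma eta_symm (a b : Fin 4) : eta a b = eta b a := by
  unfold eta
  split_ifs <;> simp_all

lemma weyl_eq {d : SpinDyad g} {L : ℝ} (hL : ∀ a b x, ricci D d a b x = 6 * L * eta a b)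
    (a b c f : Fin 4) (x : M) :
    weyl D d a b c f x
      = riemann D d a b c f x - 2 * L * (eta a c * eta b f - eta a f * eta b c) := by
  have hs : scalarCurv D d x = 24 * L := by
    unfold scalarCurv
    rw [sum_eta]
    simp only [hL]
    simp [eta]
    ring
  unfold weyl
  rw [hs]
  simp only [hL]
  ring

lemma isEinsteinTensor_weyl (hD : IsLeviCivita g D) {d : SpinDyad g} {L : ℝ}
    (hL : ∀ a b x, ricci D d a b x = 6 * L * eta a b) (x : M) :
    IsEinsteinTensor (fun a b c f => weyl D d a b c f x) 0 where
  left a b c f := by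
    simp only [weyl_eq hL, riemann_antisymm_left a b c f x]
    ring
  right a b c f := by
    simp only [weyl_eq hL, riemann_antisymm_right hD a b c f x]
    ring
  cyclic a b c f := by
    simp only [weyl_eq hL]
    rw [eta_symm c a, eta_symm b a, eta_symm c b]
    linear_combination riemann_cyclic (d := d) hD a b c f x
  einstein a c := by
    have h := hL a c x
    unfold ricci at h
    rw [sum_eta] at h ⊢
    simp only [weyl_eq hL]
    have h4 : ∀ a c, 3 * eta a c = (eta a c * eta 0 0 - eta a 0 * eta 0 c)
        - (eta a c * eta 1 1 - eta a 1 * eta 1 c) - (eta a c * eta 2 2 - eta a 2 * eta 2 c)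
        - (eta a c * eta 3 3 - eta a 3 * eta 3 c) := by
      intro a c
      fin_cases a <;> fin_cases c <;> simp [eta] <;> norm_num
    linear_combination h + 2 * L * h4 a c

lemma weylSpinor_eq_sdCurv (d : SpinDyad g) (A B C E : Fin 2) (x : M) :
    weylSpinor D d A B C E x = sdCurv (fun a b c f => weyl D d a b c f x) A B C E := by
  simp only [weylSpinor, sdCurv, sdPart, Fin.sum_univ_two, eps, Matrix.cons_val_zero,
    Matrix.cons_val_one, Matrix.cons_val', Matrix.cons_val_fin_one, zero_mul, mul_zero, one_mul,
    zero_add, add_zero, Finset.mul_sum, ← Finset.sum_add_distrib]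
  refine Finset.sum_congr rfl fun a _ => Finset.sum_congr rfl fun b _ => ?_
  refine Finset.sum_congr rfl fun c _ => Finset.sum_congr rfl fun f _ => ?_
  ring

/-- The curvature spinor as smooth functions. -/
lemma nullCurv_apply (hD : IsLeviCivita g D) {d : SpinDyad g} {L : ℝ}
    (hL : ∀ a b x, ricci D d a b x = 6 * L * eta a b) (A A' B B' C E : Fin 2) (x : M) :
    (nullCurv hD d A A' B B' C E).1 x = eps A' B' * ∑ F, eps E F *
      (weylSpinor D d A B C F x + L * (eps A C * eps B F + eps A F * eps B C)) := by
  have hR := isEinsteinTensor_riemann (d := d) hD hL x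
  have hw : ∀ F, weylSpinor D d A B C F x + L * (eps A C * eps B F + eps A F * eps B C)
      = sdCurv (fun a b c f => riemann D d a b c f x) A B C F := by
    intro F
    rw [weylSpinor_eq_sdCurv, ← sdCurv_const]
    simp only [weyl_eq hL]
    rw [sdCurv_sub]
    ring
  simp only [hw, sdCurv]
  have key : ∀ F, ∑ a, ∑ b, ivdw A A' a * ivdw B B' b
      * sdPart (fun c f => (riemann D d a b c f x : ℂ)) C F
      = eps A' B' * sdPart (fun a b => sdPart (fun c f => (riemann D d a b c f x : ℂ)) C F) A B := by
    intro F
    rw [sum_ivdw_ivdw (hR.left_sd C F), hR.asdPart_sdPart]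
    ring
  simp only [nullCurv, contr_apply, curvForm_spinFun]
  have e : ∀ F, eps A' B' * (eps E F
      * sdPart (fun a b => sdPart (fun c f => (riemann D d a b c f x : ℂ)) C F) A B)
      = eps E F * ∑ a, ∑ b, ivdw A A' a * ivdw B B' b
      * sdPart (fun c f => (riemann D d a b c f x : ℂ)) C F := by
    intro F
    rw [key]; ring
  simp only [Finset.mul_sum, e]
  conv_rhs => rw [Finset.sum_comm]
  refine Finset.sum_congr rfl fun a _ => ?_
  conv_rhs => rw [Finset.sum_comm]
  refine Finset.sum_congr rfl fun b _ => ?_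
  simp only [sdMix, Finset.mul_sum]
  exact Finset.sum_congr rfl fun F _ => by ring

lemma weylSpinor_smooth (hD : IsLeviCivita g D) {d : SpinDyad g} {L : ℝ}
    (hL : ∀ a b x, ricci D d a b x = 6 * L * eta a b) (A B C E : Fin 2) :
    ContMDiff (𝓡 4) 𝓘(ℝ, ℂ) ∞ (weylSpinor D d A B C E) := by
  have h : weylSpinor D d A B C E = (∑ F, eps F E • nullCurv hD d A 0 B 1 C F
      - algebraMap ℂ _ (L * (eps A C * eps B E + eps A E * eps B C)) : SmoothFun M).1 := by
    funext x
    have hc : (algebraMap ℂ (SmoothFun M) (L * (eps A C * eps B E + eps A E * eps B C))).1 x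
      = L * (eps A C * eps B E + eps A E * eps B C) := rfl
    rw [SmoothFun.sub_apply, hc]
    simp only [SmoothFun.sum_apply, SmoothFun.smul_apply, nullCurv_apply hD hL]
    fin_cases E <;> simp [eps]
  rw [h]
  exact Subtype.property _

/-- The components of the Weyl spinor as smooth functions. -/
def weylFun (hD : IsLeviCivita g D) {d : SpinDyad g} {L : ℝ}
    (hL : ∀ a b x, ricci D d a b x = 6 * L * eta a b) (A B C E : Fin 2) : SmoothFun M :=
  ⟨weylSpinor D d A B C E, weylSpinor_smooth hD hL A B C E⟩

lemma weylContr_eq (d : SpinDyad g) (x : M) :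
    Psi0 D d x = weylSpinor D d 0 0 0 0 x ∧ Psi1 D d x = weylSpinor D d 0 0 0 1 x ∧
    Psi2 D d x = weylSpinor D d 0 0 1 1 x ∧ Psi3 D d x = weylSpinor D d 0 1 1 1 x := by
  refine ⟨?_, ?_, ?_, ?_⟩ <;>
  simp [Psi0, Psi1, Psi2, Psi3, weylContr, o, iota]

/-- The null frame and the spin connection of a spin dyad. -/
def spinFrame (hD : IsLeviCivita g D) (d : SpinDyad g) : SpinFrame (SmoothFun M) where
  der := nullDer d
  coeff := nullSpin hD d
  coeffConj := nullSpinConj hD d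

lemma spinFrame_curv (hD : IsLeviCivita g D) (d : SpinDyad g) (A A' B B' C E : Fin 2) :
    (spinFrame hD d).curv A A' B B' C E = nullCurv hD d A A' B B' C E :=
  (nullCurv_eq hD d A A' B B' C E).symm

lemma spinCoeff_trace (hD : IsLeviCivita g D) (d : SpinDyad g) (a : Fin 4) (x : M) :
    spinCoeff D d a 1 1 x = - spinCoeff D d a 0 0 x := by
  have hu : ∀ b c, (connCoeff D d a c b x : ℂ) = - (connCoeff D d a b c x : ℂ) := by
    intro b c
    rw [connCoeff_antisymm hD]; push_cast; rfl
  rw [spinCoeff_eq_sdMix, spinCoeff_eq_sdMix, sdMix_eq hu]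
  simp
  ring

lemma spinFrame_isTorsionFree (hD : IsLeviCivita g D) (d : SpinDyad g) :
    (spinFrame hD d).IsTorsionFree where
  trace A A' := by
    refine SmoothFun.ext fun x => ?_
    simp only [spinFrame, nullSpin, SmoothFun.neg_apply, contr_apply, spinFun_apply,
      spinCoeff_trace hD, mul_neg, Finset.sum_neg_distrib]
  traceConj A A' := by
    refine SmoothFun.ext fun x => ?_
    have h3 : ∀ a B C, (conjFun (spinFun hD d a B C)).1 x
        = (starRingEnd ℂ) (spinCoeff D d a B C x) := by
      intro a B C
      rw [← spinFun_apply hD]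
      rfl
    simp only [spinFrame, nullSpinConj, SmoothFun.neg_apply, contr_apply, h3,
      spinCoeff_trace hD, map_neg, mul_neg, Finset.sum_neg_distrib]
  comm := nullDer_comm hD d

/-- An Einstein metric of type II. -/
lemma spinFrame_isTypeIIEinstein (hD : IsLeviCivita g D) {d : SpinDyad g} {L : ℝ}
    (hL : ∀ a b x, ricci D d a b x = 6 * L * eta a b) (hII : IsTypeII D d) :
    (spinFrame hD d).IsTypeIIEinstein (weylFun hD hL 0 0 1 1) (weylFun hD hL 0 1 1 1)
      (weylFun hD hL 1 1 1 1) (algebraMap ℂ _ (L : ℂ)) := by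
  have hcurv : ∀ A A' B B' C E, (spinFrame hD d).curv A A' B B' C E
      = eps A' B' • SpinFrame.typeIICurv (weylFun hD hL 0 0 1 1) (weylFun hD hL 0 1 1 1)
        (weylFun hD hL 1 1 1 1) (algebraMap ℂ _ (L : ℂ)) A B C E := by
    intro A A' B B' C E
    refine SmoothFun.ext fun x => ?_
    rw [spinFrame_curv, nullCurv_apply hD hL, SmoothFun.smul_apply]
    congr 1
    have hs := (isEinsteinTensor_weyl (d := d) hD hL x).sdCurv_symm
    simp only [← weylSpinor_eq_sdCurv] at hs
    obtain ⟨e0, e1, e2, e3⟩ := weylContr_eq (D := D) d x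
    obtain ⟨h0, h1, -⟩ := hII x
    rw [e0] at h0
    rw [e1] at h1
    have hl : (algebraMap ℂ (SmoothFun M) (L : ℂ)).1 x = L := rfl
    have hwf : ∀ A B C E, (weylFun hD hL A B C E).1 x = weylSpinor D d A B C E x :=
      fun _ _ _ _ => rfl
    have h2 : ((2 : SmoothFun M)).1 x = 2 := rfl
    fin_cases A <;> fin_cases B <;> fin_cases C <;> fin_cases E <;>
    simp [SpinFrame.typeIICurv, eps, hs 0 0 1 0, hs 0 1 0 0, hs 0 1 0 1, hs 0 1 1 0, hs 1 0 0 0,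
      hs 1 0 0 1, hs 1 0 1 0, hs 1 0 1 1, hs 1 1 0 0, hs 1 1 0 1, hs 1 1 1 0, h0, h1,
      hl, hwf, h2] <;> ring
  refine { spinFrame_isTorsionFree hD d with
    bianchi := ?_, curv_same := ?_, curv_zero_one := ?_, curv_one_zero := ?_, der_const := ?_ }
  · intro A A' B B' C C' P Q
    have h : ∀ A A' B B' C C' P Q, (spinFrame hD d).bianchiTerm A A' B B' C C' P Q
        = bianchiTerm hD d A A' B B' C C' P Q := by
      intro A A' B B' C C' P Q
      simp only [SpinFrame.bianchiTerm, spinFrame_curv]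
      rfl
    rw [h, h, h]
    exact null_bianchi hD d A A' B B' C C' P Q
  · intro A A' B C E
    rw [hcurv]
    fin_cases A' <;> simp [eps]
  · intro A B C E
    rw [hcurv]
    simp [eps]
  · intro A B C E
    rw [hcurv]
    simp [eps]
  · intro A A'
    exact Derivation.map_algebraMap _ _

lemma nullDer_apply (d : SpinDyad g) (A A' : Fin 2) (f : SmoothFun M) (x : M) :
    (nullDer d A A' f).1 x = ∑ a, ivdw A A' a * frameDeriv d a f.1 x := by
  rw [nullDer, contr_derivation_apply, contr_apply]
  rfl

lemma nullSpin_apply (hD : IsLeviCivita g D) (d : SpinDyad g) (A A' B C : Fin 2) (x : M) :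
    (nullSpin hD d A A' B C).1 x = ∑ a, ivdw A A' a * spinCoeff D d a B C x := by
  simp only [nullSpin, contr_apply, spinFun_apply]

lemma nullSpinConj_apply (hD : IsLeviCivita g D) (d : SpinDyad g) (A A' B C : Fin 2) (x : M) :
    (nullSpinConj hD d A A' B C).1 x
      = ∑ a, ivdw A A' a * (starRingEnd ℂ) (spinCoeff D d a B C x) := by
  simp only [nullSpinConj, contr_apply, ← spinFun_apply hD]
  rfl

lemma nabla2_apply (hD : IsLeviCivita g D) (d : SpinDyad g) (K : Fin 2 → Fin 2 → SmoothFun M)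
    (A A' B C : Fin 2) (x : M) :
    ((spinFrame hD d).nabla2 K A A' B C).1 x
      = nablaK D d (fun B C => (K B C).1) A A' B C x := by
  simp only [SpinFrame.nabla2, spinFrame, SmoothFun.sub_apply, SmoothFun.add_apply,
    SmoothFun.mul_apply, nullDer_apply, nullSpin_apply, nablaK, mul_sub, Finset.sum_sub_distrib,
    Fin.sum_univ_two, Finset.sum_mul, mul_add, Finset.sum_add_distrib, mul_assoc]

lemma nablaVec_apply (hD : IsLeviCivita g D) (d : SpinDyad g) (xi : Fin 2 → Fin 2 → SmoothFun M)
    (A A' B B' : Fin 2) (x : M) :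
    ((spinFrame hD d).nablaVec xi A A' B B').1 x
      = nablaXi D d (fun B C => (xi B C).1) A A' B B' x := by
  simp only [SpinFrame.nablaVec, spinFrame, SmoothFun.sub_apply, SmoothFun.add_apply,
    SmoothFun.mul_apply, nullDer_apply, nullSpin_apply, nullSpinConj_apply, nablaXi, mul_sub,
    Finset.sum_sub_distrib, Fin.sum_univ_two, Finset.sum_mul, mul_add, Finset.sum_add_distrib,
    mul_assoc]

end EinsteinTypeII

end TypeII

end

theorem typeII_projected_killing_vector
    {M : Type*} [TopologicalSpace M] [ChartedSpace (EuclideanSpace ℝ (Fin 4)) M]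
    [IsManifold (𝓡 4) ∞ M]
    (g : TypeII.LorentzMetric M)
    -- the Levi-Civita connection of `g`
    (D : TypeII.AffineConnection M) (hD : TypeII.IsLeviCivita g D)
    -- the spin dyad `(o, ι)`
    (d : TypeII.SpinDyad g)
    (hE : TypeII.IsEinstein D d) (hII : TypeII.IsTypeII D d)
    -- a smooth branch `φ` of `Ψ₂^{1/3}`
    (phi : M → ℂ) (hphi : ContMDiff (𝓡 4) 𝓘(ℝ, ℂ) ∞ phi)
    (hcube : ∀ x, phi x ^ 3 = TypeII.Psi2 D d x) :
    -- `o^A (∇_{AA'} ξ_{BB'} + ∇_{BB'} ξ_{AA'}) = 0`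
    ∀ (x : M) (A' B B' : Fin 2),
      ∑ A, TypeII.o A *
        (TypeII.nablaXi D d (TypeII.projXi D d phi) A A' B B' x
          + TypeII.nablaXi D d (TypeII.projXi D d phi) B B' A A' x) = 0 := by
  open TypeII in
  intro x A' B B'
  obtain ⟨L, hL⟩ := hE
  have hne : ∀ y, phi y ≠ 0 := by
    intro y h0
    apply (hII y).2.2
    rw [← hcube y, h0]
    simp
  have hinv : ContMDiff (𝓡 4) 𝓘(ℝ, ℂ) ∞ (fun y => (phi y)⁻¹) := fun y =>
    (contDiffAt_inv ℝ (hne y)).contMDiffAt.comp y (hphi y)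
  let φ : SmoothFun M := ⟨phi, hphi⟩
  let ψ : SmoothFun M := ⟨fun y => (phi y)⁻¹, hinv⟩
  let p₃ := weylFun hD hL 0 1 1 1
  let k : SmoothFun M := (-1 / 2 : ℂ) • ψ
  let q : SmoothFun M := (-1 / 3 : ℂ) • (ψ * ψ * ψ * ψ * p₃)
  let K : Fin 2 → Fin 2 → SmoothFun M := ![![0, k], ![k, q]]
  have hK : (fun B C => (K B C).1) = projK D d phi := by
    funext B C y
    have h3 : p₃.1 y = Psi3 D d y := (weylContr_eq d y).2.2.2.symm
    have hk : k.1 y = (-1 / 2) * (phi y)⁻¹ := rfl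
    have hq : q.1 y = (-1 / 3) * ((phi y)⁻¹ * (phi y)⁻¹ * (phi y)⁻¹ * (phi y)⁻¹ * Psi3 D d y) := by
      rw [← h3]; rfl
    fin_cases B <;> fin_cases C <;> simp [K, projK, lower, o, iota, eps, hk, hq] <;> ring
  have hxi : (fun A A' => ((spinFrame hD d).divK K A A').1) = projXi D d phi := by
    funext A A' y
    simp only [SpinFrame.divK, SmoothFun.sub_apply, nabla2_apply, hK, projXi]
    simp [eps]
    ring
  have key := (spinFrame_isTypeIIEinstein hD hL hII).projected_killing (φ := φ) (ψ := ψ) (K := K)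
    (SmoothFun.ext fun y => ?_) (SmoothFun.ext fun y => ?_) rfl rfl (SmoothFun.ext fun y => ?_)
    (SmoothFun.ext fun y => ?_) A' B B'
  · have key' := congrArg (fun f : SmoothFun M => f.1 x) key
    have h2 : (2 : SmoothFun M).1 x = 2 := rfl
    simp only [SmoothFun.mul_apply, SmoothFun.add_apply, SmoothFun.zero_apply, nablaVec_apply, hxi,
      h2] at key'
    simpa [o] using key'
  · change phi y * phi y * phi y = weylSpinor D d 0 0 1 1 y
    rw [← (weylContr_eq d y).2.2.1, ← hcube y]
    ring
  · exact mul_inv_cancel₀ (hne y)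
  · change 2 * ((-1 / 2) * (phi y)⁻¹) = - (phi y)⁻¹
    ring
  · change 3 * ((-1 / 3) * (ψ.1 y * ψ.1 y * ψ.1 y * ψ.1 y * p₃.1 y))
      = - (ψ.1 y * ψ.1 y * ψ.1 y * ψ.1 y) * p₃.1 y
    ring
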